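/- arXiv:2010.14424 — 4 statements merged into one kernel-verified Lean document; each statement's English description precedes it below -/
import Mathlib

section
/- Let L > 0, ε > 0, α, β ∈ (0,1), and let k : [0,L] → ℝ be continuous with k(x) ≥ k₀ for all x, for some constant k₀ > 0. Then there exists a classical solution (ρ, J) of the area-averaged pedestrian boundary value problem such that 0 < ρ(x) < 1 for every x ∈ [0,L]. -/
open Set

/-- A classical solution `(ρ, J)` (with derivative `ρ'`) of the area-averaged pedestrian
boundary value problem on `[0, L]` with diffusion `ε`, inflow rate `α`, outflow rate `β`
and width function `k`. -/
def IsClassicalSolution (L ε α β : ℝ) (k ρ ρ' : ℝ → ℝ) (J : ℝ) : Prop :=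
  (∀ x ∈ Icc (0:ℝ) L, HasDerivWithinAt ρ (ρ' x) (Icc 0 L) x) ∧
  ContinuousOn ρ' (Icc 0 L) ∧
  (∀ x ∈ Icc (0:ℝ) L, k x * (-ε * ρ' x + ρ x * (1 - ρ x)) = J) ∧
  -ε * ρ' 0 + ρ 0 * (1 - ρ 0) = α * (1 - ρ 0) ∧
  -ε * ρ' L + ρ L * (1 - ρ L) = β * ρ L

/-- The flux `y * (1 - y)` evaluated at the projection of `y` onto `[0, 1]`. -/
noncomputable def clampedFlux (y : ℝ) : ℝ :=
  max 0 (min y 1) * (1 - max 0 (min y 1))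

lemma clampedFlux_of_mem {y : ℝ} (h0 : 0 ≤ y) (h1 : y ≤ 1) : clampedFlux y = y * (1 - y) := by
  simp [clampedFlux, h0, h1]

lemma abs_clampedFlux_le_one (y : ℝ) : |clampedFlux y| ≤ 1 := by
  have h0 : 0 ≤ max 0 (min y 1) := le_max_left _ _
  have h1 : max 0 (min y 1) ≤ 1 := max_le zero_le_one (min_le_right _ _)
  rw [clampedFlux, abs_le]
  constructor <;> nlinarith

lemma lipschitzWith_clampedFlux : LipschitzWith 1 clampedFlux := by
  refine LipschitzWith.of_dist_le_mul fun y z => ?_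
  have hclamp : LipschitzWith 1 fun y : ℝ => max 0 (min y 1) :=
    (LipschitzWith.id.min_const 1).const_max 0
  have hyz := hclamp.dist_le_mul y z
  simp only [NNReal.coe_one, one_mul, Real.dist_eq] at hyz ⊢
  have bounds : ∀ y : ℝ, 0 ≤ max 0 (min y 1) ∧ max 0 (min y 1) ≤ 1 := fun y =>
    ⟨le_max_left _ _, max_le zero_le_one (min_le_right _ _)⟩
  obtain ⟨hy0, hy1⟩ := bounds y
  obtain ⟨hz0, hz1⟩ := bounds z
  unfold clampedFlux
  generalize max 0 (min y 1) = c at *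
  generalize max 0 (min z 1) = d at *
  calc |c * (1 - c) - d * (1 - d)| = |c - d| * |1 - c - d| := by rw [← abs_mul]; ring_nf
    _ ≤ |c - d| * 1 := by gcongr; rw [abs_le]; constructor <;> linarith
    _ ≤ |y - z| := by rwa [mul_one]

lemma HasDerivWithinAt.Ici_of_Icc {f : ℝ → ℝ} {f' a b x : ℝ}
    (hf : HasDerivWithinAt f f' (Icc a b) x) (hx : x ∈ Ico a b) :
    HasDerivWithinAt f f' (Ici x) x :=
  hf.mono_of_mem_nhdsWithin (Icc_mem_nhdsGE_of_mem hx)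

/-- Global existence for a scalar equation with bounded Lipschitz nonlinearity and continuous
forcing. -/
lemma exists_forall_hasDerivWithinAt_add {L C : ℝ} {K : NNReal} {g u : ℝ → ℝ} (hL : 0 ≤ L)
    (hg : LipschitzWith K g) (hgC : ∀ y, |g y| ≤ C) (hu : ContinuousOn u (Icc 0 L)) (a : ℝ) :
    ∃ f : ℝ → ℝ, f 0 = a ∧ ∀ t ∈ Icc 0 L, HasDerivWithinAt f (g (f t) + u t) (Icc 0 L) t := by
  obtain ⟨U, hU⟩ := isCompact_Icc.exists_bound_of_continuousOn hu
  have hC : 0 ≤ C := (abs_nonneg _).trans (hgC 0)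
  have hU0 : 0 ≤ U := (norm_nonneg _).trans (hU 0 ⟨le_rfl, hL⟩)
  have hpl : IsPicardLindelof (fun t y => g y + u t) (tmin := 0) (tmax := L) ⟨0, le_rfl, hL⟩ a
      ((C + U).toNNReal * L.toNNReal) 0 (C + U).toNNReal K :=
    { lipschitzOnWith := fun t _ =>
        (LipschitzWith.of_dist_le_mul fun y z => by
          simpa using hg.dist_le_mul y z).lipschitzOnWith
      continuousOn := fun y _ => continuousOn_const.add hu
      norm_le := fun t ht y _ => by
        rw [Real.coe_toNNReal _ (by positivity)]
        exact (norm_add_le _ _).trans (add_le_add (hgC y) (hU t ht))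
      mul_max_le := by
        simp [hL] }
  exact hpl.exists_eq_forall_mem_Icc_hasDerivWithinAt₀

/-- Continuous dependence on the initial value and the forcing. -/
lemma abs_sub_le_gronwallBound {L δ η : ℝ} {K : NNReal} {g u₁ u₂ f₁ f₂ : ℝ → ℝ} (hL : 0 ≤ L)
    (hg : LipschitzWith K g)
    (h₁ : ∀ t ∈ Icc 0 L, HasDerivWithinAt f₁ (g (f₁ t) + u₁ t) (Icc 0 L) t)
    (h₂ : ∀ t ∈ Icc 0 L, HasDerivWithinAt f₂ (g (f₂ t) + u₂ t) (Icc 0 L) t)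
    (hu : ∀ t ∈ Icc 0 L, |u₁ t - u₂ t| ≤ η) (h0 : |f₁ 0 - f₂ 0| ≤ δ) :
    |f₁ L - f₂ L| ≤ gronwallBound δ K η L := by
  have h := dist_le_of_approx_trajectories_ODE (v := fun t y => g y + u₂ t) (εf := η) (εg := 0)
    (fun t => LipschitzWith.of_dist_le_mul fun y z => by simpa using hg.dist_le_mul y z)
    (fun t ht => (h₁ t ht).continuousWithinAt)
    (fun t ht => (h₁ t (Ico_subset_Icc_self ht)).Ici_of_Icc ht)
    (fun t ht => by simpa [Real.dist_eq] using hu t (Ico_subset_Icc_self ht))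
    (fun t ht => (h₂ t ht).continuousWithinAt)
    (fun t ht => (h₂ t (Ico_subset_Icc_self ht)).Ici_of_Icc ht)
    (fun t _ => (dist_self _).le) h0 L ⟨hL, le_rfl⟩
  simpa [Real.dist_eq] using h

/-- A function that decreases strictly whenever it takes the value `m` cannot cross `m` upwards. -/
lemma le_of_deriv_neg_of_eq {f f' : ℝ → ℝ} {L m a b : ℝ}
    (hf : ∀ t ∈ Icc 0 L, HasDerivWithinAt f (f' t) (Icc 0 L) t)
    (hneg : ∀ t ∈ Icc 0 L, f t = m → f' t < 0) (ha : 0 ≤ a) (hab : a ≤ b) (hb : b ≤ L)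
    (hfa : f a ≤ m) : f b ≤ m := by
  have hsub : Icc a b ⊆ Icc 0 L := Icc_subset_Icc ha hb
  exact image_le_of_deriv_right_lt_deriv_boundary (B := fun _ => m) (B' := fun _ => 0)
    (fun t ht => (hf t (hsub ht)).continuousWithinAt.mono hsub)
    (fun t ht => ((hf t (hsub (Ico_subset_Icc_self ht))).mono hsub).Ici_of_Icc ht) hfa
    (fun t => hasDerivAt_const t m) (fun t ht => hneg t (hsub (Ico_subset_Icc_self ht)))
    ⟨hab, le_rfl⟩

/-- Existence of a classical solution with `0 < ρ < 1`. -/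
theorem existence_classical_solution
    (L ε α β k₀ : ℝ) (k : ℝ → ℝ)
    (hL : 0 < L) (hε : 0 < ε) (hα : α ∈ Ioo (0:ℝ) 1) (hβ : β ∈ Ioo (0:ℝ) 1)
    (hk₀ : 0 < k₀) (hk : ∀ x ∈ Icc (0:ℝ) L, k₀ ≤ k x)
    (hkc : ContinuousOn k (Icc 0 L)) :
    ∃ (ρ ρ' : ℝ → ℝ) (J : ℝ), IsClassicalSolution L ε α β k ρ ρ' J ∧
      ∀ x ∈ Icc (0:ℝ) L, 0 < ρ x ∧ ρ x < 1 := by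
  obtain ⟨hα0, hα1⟩ := hα
  obtain ⟨hβ0, hβ1⟩ := hβ
  have mem0 : (0:ℝ) ∈ Icc 0 L := ⟨le_rfl, hL.le⟩
  have memL : L ∈ Icc 0 L := ⟨hL.le, le_rfl⟩
  have hkpos : ∀ x ∈ Icc 0 L, 0 < k x := fun x hx => hk₀.trans_le (hk x hx)
  have hk0 := hkpos 0 mem0
  have hkL := hkpos L memL
  -- shooting family: `J a` is the current determined by the inflow condition with `ρ 0 = a`
  let J : ℝ → ℝ := fun a => k 0 * (α * (1 - a))
  let u : ℝ → ℝ → ℝ := fun a t => -(J a / k t) / ε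
  let g : ℝ → ℝ := fun y => clampedFlux y / ε
  let K : NNReal := (1 / ε).toNNReal
  have hKε : (K : ℝ) = 1 / ε := Real.coe_toNNReal _ (by positivity)
  have hg : LipschitzWith K g := LipschitzWith.of_dist_le_mul fun y z => by
    have h := lipschitzWith_clampedFlux.dist_le_mul y z
    simp only [Real.dist_eq, NNReal.coe_one, one_mul] at h ⊢
    rw [hKε, ← sub_div, abs_div, abs_of_pos hε, div_mul_eq_mul_div, one_mul]
    gcongr
  have hgC : ∀ y, |g y| ≤ 1 / ε := fun y => by
    rw [abs_div, abs_of_pos hε]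
    gcongr
    exact abs_clampedFlux_le_one y
  have hu : ∀ a, ContinuousOn (u a) (Icc 0 L) := fun a =>
    ((continuousOn_const.div hkc fun x hx => (hkpos x hx).ne').neg).div_const ε
  choose ρ hρ0 hρ using fun a => exists_forall_hasDerivWithinAt_add hL.le hg hgC (hu a) a
  have hρcont : Continuous fun a => ρ a L := by
    let W : ℝ := k 0 * α / (k₀ * ε)
    have hW : 0 ≤ W := by positivity
    let M : ℝ := gronwallBound 1 K W L
    have hlip : ∀ a b, |ρ a L - ρ b L| ≤ M * |a - b| := fun a b => by
      have hub : ∀ t ∈ Icc 0 L, |u a t - u b t| ≤ W * |a - b| := fun t ht => by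
        have hkt := hkpos t ht
        have e : u a t - u b t = k 0 * α / (k t * ε) * (a - b) := by
          simp only [u, J]; field_simp; ring
        rw [e, abs_mul, abs_of_nonneg (by positivity)]
        have hle := hk t ht
        change k 0 * α / (k t * ε) * |a - b| ≤ k 0 * α / (k₀ * ε) * |a - b|
        gcongr
      have h := abs_sub_le_gronwallBound hL.le hg (hρ a) (hρ b) hub
        (by rw [hρ0, hρ0])
      refine h.trans_eq ?_
      have hK : (K : ℝ) ≠ 0 := by rw [hKε]; positivity
      simp only [M, gronwallBound_of_K_ne_0 hK]
      ring
    exact (LipschitzWith.of_dist_le' hlip).continuous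
  have hneg0 : ∀ a < 1, ∀ t ∈ Icc 0 L, ρ a t = 0 → g (ρ a t) + u a t < 0 := fun a ha t ht h => by
    have hkt := hkpos t ht
    have hJ : 0 < J a := mul_pos hk0 (mul_pos hα0 (by linarith))
    have : 0 < J a / k t / ε := by positivity
    simp only [g, u, h, neg_div, clampedFlux_of_mem le_rfl zero_le_one, zero_mul, zero_div]
    linarith
  have hend1 : 0 < ρ 1 L := by
    have h : -ρ 1 L ≤ -(1 / 2) := by
      refine le_of_deriv_neg_of_eq (f := fun t => -ρ 1 t) (fun t ht => (hρ 1 t ht).neg)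
        (fun t ht h => ?_) le_rfl hL.le le_rfl (by rw [hρ0]; norm_num)
      rw [neg_inj] at h
      simp only [g, u, J, h, clampedFlux_of_mem (y := 1 / 2) (by norm_num) (by norm_num)]
      norm_num
      exact hε
    linarith
  obtain ⟨a, ⟨ha0, ha1⟩, ha⟩ : ∃ a ∈ Icc (0:ℝ) 1, k L * (β * ρ a L) - J a = 0 := by
    refine intermediate_value_Icc zero_le_one (f := fun a => k L * (β * ρ a L) - J a)
      (by fun_prop) ⟨?_, ?_⟩
    · have h := le_of_deriv_neg_of_eq (hρ 0) (hneg0 0 one_pos) le_rfl hL.le le_rfl (hρ0 0).le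
      have h1 : k L * (β * ρ 0 L) ≤ 0 :=
        mul_nonpos_of_nonneg_of_nonpos hkL.le (mul_nonpos_of_nonneg_of_nonpos hβ0.le h)
      have h2 : 0 ≤ J 0 := by simp only [J]; norm_num; positivity
      linarith
    · have : 0 ≤ k L * (β * ρ 1 L) := by positivity
      simpa [J] using this
  have ha1 : a < 1 := by
    refine lt_of_le_of_ne ha1 fun h => ?_
    subst h
    have : 0 < k L * (β * ρ 1 L) := by positivity
    simp only [J, sub_self, mul_zero, sub_zero] at ha
    linarith
  have hJ : 0 < J a := mul_pos hk0 (mul_pos hα0 (by linarith))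
  have hpos : ∀ t ∈ Icc 0 L, 0 < ρ a t := by
    intro t ht
    by_contra! h
    have hend := le_of_deriv_neg_of_eq (hρ a) (hneg0 a ha1) ht.1 ht.2 le_rfl h
    have : k L * (β * ρ a L) ≤ 0 :=
      mul_nonpos_of_nonneg_of_nonpos hkL.le (mul_nonpos_of_nonneg_of_nonpos hβ0.le hend)
    linarith
  have hlt : ∀ t ∈ Icc 0 L, ρ a t < 1 := by
    obtain ⟨B, hB⟩ := isCompact_Icc.exists_bound_of_continuousOn hkc
    have hkB : ∀ t ∈ Icc 0 L, k t ≤ B := fun t ht => (le_abs_self _).trans (hB t ht)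
    have hB0 : 0 < B := hk0.trans_le (hkB 0 mem0)
    let m : ℝ := max a (1 - J a / (2 * B))
    have hJB : 0 < J a / (2 * B) := by positivity
    have hm1 : m < 1 := max_lt ha1 (by linarith)
    have hm0 : 0 ≤ m := ha0.trans (le_max_left _ _)
    have hm : 1 - J a / (2 * B) ≤ m := le_max_right _ _
    intro t ht
    refine (le_of_deriv_neg_of_eq (hρ a) (fun s hs h => ?_) le_rfl ht.1 ht.2
      ((hρ0 a).trans_le (le_max_left a (1 - J a / (2 * B))))).trans_lt hm1
    have hks := hkpos s hs
    have hle : J a / B ≤ J a / k s := by gcongr; exact hkB s hs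
    have hhalf : J a / (2 * B) = J a / B / 2 := by ring
    have hmm : m * (1 - m) ≤ 1 - m := by nlinarith
    change clampedFlux (ρ a s) / ε + -(J a / k s) / ε < 0
    rw [h, clampedFlux_of_mem hm0 hm1.le, ← add_div]
    exact div_neg_of_neg_of_pos (by linarith) hε
  have hρ' : ∀ t ∈ Icc 0 L, g (ρ a t) + u a t = (ρ a t * (1 - ρ a t) - J a / k t) / ε := by
    intro t ht
    simp only [g, u, clampedFlux_of_mem (hpos t ht).le (hlt t ht).le]
    ring
  have hflux : ∀ t ∈ Icc 0 L,
      -ε * (g (ρ a t) + u a t) + ρ a t * (1 - ρ a t) = J a / k t := by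
    intro t ht
    rw [hρ' t ht]
    field_simp
    ring
  refine ⟨ρ a, fun t => g (ρ a t) + u a t, J a, ⟨hρ a, ?_, fun t ht => ?_, ?_, ?_⟩,
    fun t ht => ⟨hpos t ht, hlt t ht⟩⟩
  · exact (hg.continuous.comp_continuousOn fun t ht => (hρ a t ht).continuousWithinAt).add (hu a)
  · rw [hflux t ht, mul_div_cancel₀ _ (hkpos t ht).ne']
  · rw [hflux 0 mem0, hρ0, div_eq_iff hk0.ne', mul_comm]
  · rw [hflux L memL, div_eq_iff hkL.ne', mul_comm]
    linarith
end

section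
/- Assume 0 < α < ρ_f, ρ*(α) < β < 1 and β ≠ 1 − ρ*(α). Suppose that for every ε > 0, (ρ_ε, J_ε) is a classical solution of the area-averaged pedestrian boundary value problem on [0,1] with diffusion ε. Then for every fixed x ∈ [0,1), ρ_ε(x) → (1/2)·(1 − √(1 − 4α(1−α)·k(0)/k(x))) as ε → 0⁺. -/
open Set Filter

/-- `ρ_f = (1/2)·(1 − √(1 − k(1)/k(0)))`. -/
noncomputable def rhoF (k : ℝ → ℝ) : ℝ := (1/2) * (1 - Real.sqrt (1 - k 1 / k 0))

/-- `ρ*(α) = (1/2)·(1 − √(1 − 4α(1−α)·k(0)/k(1)))`. -/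
noncomputable def rhoStar (α : ℝ) (k : ℝ → ℝ) : ℝ :=
  (1/2) * (1 - Real.sqrt (1 - 4*α*(1-α) * k 0 / k 1))

/-- `ρ_*(β) = (1/2)·(1 + √(1 − 4β(1−β)·k(1)/k(0)))`. -/
noncomputable def rhoStarLow (β : ℝ) (k : ℝ → ℝ) : ℝ :=
  (1/2) * (1 + Real.sqrt (1 - 4*β*(1-β) * k 1 / k 0))

/-- A function starting above a line stays above it if its derivative exceeds the slope of the
line wherever the two meet. -/
theorem line_le_of_slope_lt_deriv {f f' : ℝ → ℝ} {x₀ x₁ a d : ℝ} (hx₀ : 0 ≤ x₀) (hx : x₀ ≤ x₁)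
    (hx₁ : x₁ ≤ 1) (hf : ∀ x ∈ Icc (0:ℝ) 1, HasDerivWithinAt f (f' x) (Icc 0 1) x)
    (ha : a ≤ f x₀) (hd : ∀ x ∈ Ico x₀ x₁, a + d * (x - x₀) = f x → d < f' x) :
    a + d * (x₁ - x₀) ≤ f x₁ := by
  refine image_le_of_deriv_right_lt_deriv_boundary' (f := fun x => a + d * (x - x₀))
    (f' := fun _ => d) (a := x₀) (b := x₁) (by fun_prop) ?_ (by simpa using ha)
    (B := f) (B' := f') ?_ ?_ hd (right_mem_Icc.2 hx)
  · intro x _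
    have h := (((hasDerivAt_id x).sub_const x₀).const_mul d).const_add a
    simpa using h.hasDerivWithinAt
  · exact fun x hxm => ((hf x ⟨hx₀.trans hxm.1, hxm.2.trans hx₁⟩).continuousWithinAt).mono
      (Icc_subset_Icc hx₀ hx₁)
  · intro x hxm
    exact (hf x ⟨hx₀.trans hxm.1, (hxm.2.trans_le hx₁).le⟩).mono_of_mem_nhdsWithin
      (Icc_mem_nhdsGE_of_mem ⟨hx₀.trans hxm.1, hxm.2.trans_le hx₁⟩)

theorem antitoneOn_of_hasDerivWithinAt_neg {k k' : ℝ → ℝ}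
    (hk : ∀ x ∈ Icc (0:ℝ) 1, HasDerivWithinAt k (k' x) (Icc 0 1) x)
    (hk' : ∀ x ∈ Icc (0:ℝ) 1, k' x < 0) : AntitoneOn k (Icc 0 1) := by
  have hd : ∀ x ∈ interior (Icc (0:ℝ) 1), HasDerivAt k (k' x) x := fun x hx =>
    (hk x (interior_subset hx)).hasDerivAt (mem_interior_iff_mem_nhds.1 hx)
  refine antitoneOn_of_deriv_nonpos (convex_Icc 0 1) (fun x hx => (hk x hx).continuousWithinAt)
    (fun x hx => (hd x hx).differentiableAt.differentiableWithinAt) fun x hx => ?_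
  rw [(hd x hx).deriv]
  exact (hk' x (interior_subset hx)).le

theorem mul_one_sub_half_sub_sqrt {t : ℝ} (ht : 4 * t ≤ 1) :
    (1/2) * (1 - √(1 - 4 * t)) * (1 - (1/2) * (1 - √(1 - 4 * t))) = t := by
  have h := Real.sq_sqrt (sub_nonneg.2 ht)
  linear_combination (-1/4) * h

theorem four_mul_lt_of_lt_rhoF {α : ℝ} {k : ℝ → ℝ} (h0 : 0 < k 0) (hα : α < rhoF k) :
    4 * (α * (1 - α)) * k 0 < k 1 := by
  unfold rhoF at hα
  have h : √(1 - k 1 / k 0) < 1 - 2 * α := by linarith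
  have h2 := (Real.sqrt_lt' ((Real.sqrt_nonneg _).trans_lt h)).1 h
  have h3 : 4 * (α * (1 - α)) < k 1 / k 0 := by linarith
  exact (lt_div_iff₀ h0).1 h3

namespace IsClassicalSolution

variable {ε α β J : ℝ} {k ρ ρ' : ℝ → ℝ}

theorem flux_eq_left (h : IsClassicalSolution 1 ε α β k ρ ρ' J) :
    J = k 0 * (α * (1 - ρ 0)) := by
  rw [← h.2.2.2.1]
  exact (h.2.2.1 0 (by simp)).symm

theorem flux_eq_right (h : IsClassicalSolution 1 ε α β k ρ ρ' J) :
    J = k 1 * (β * ρ 1) := by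
  rw [← h.2.2.2.2]
  exact (h.2.2.1 1 (by simp)).symm

theorem mul_deriv_eq (h : IsClassicalSolution 1 ε α β k ρ ρ' J)
    (hk : ∀ x ∈ Icc (0:ℝ) 1, 0 < k x) {x : ℝ} (hx : x ∈ Icc (0:ℝ) 1) :
    ε * ρ' x = ρ x * (1 - ρ x) - J / k x := by
  rw [← h.2.2.1 x hx, mul_div_cancel_left₀ _ (hk x hx).ne']
  ring

theorem flux_pos (h : IsClassicalSolution 1 ε α β k ρ ρ' J) (hε : 0 < ε) (hα : 0 < α)
    (hβ : 0 < β) (hk : ∀ x ∈ Icc (0:ℝ) 1, 0 < k x) : 0 < J := by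
  by_contra! hJ
  have h0 := hk 0 (by simp)
  have h1 := hk 1 (by simp)
  have hl : 1 ≤ ρ 0 := by
    by_contra! hlt
    have := mul_pos h0 (mul_pos hα (sub_pos.2 hlt))
    linarith [h.flux_eq_left]
  have hr : ρ 1 ≤ 0 := by
    by_contra! hlt
    have := mul_pos h1 (mul_pos hβ hlt)
    linarith [h.flux_eq_right]
  have := line_le_of_slope_lt_deriv (a := 1/2) (d := 0) le_rfl zero_le_one le_rfl h.1
    (by linarith) fun x hx hxe => by
      have hxm : x ∈ Icc (0:ℝ) 1 := Ico_subset_Icc_self hx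
      have he := h.mul_deriv_eq hk hxm
      have hJk : J / k x ≤ 0 := div_nonpos_of_nonpos_of_nonneg hJ (hk x hxm).le
      have hxe' : ρ x = 1/2 := by linarith
      rw [hxe'] at he
      exact pos_of_mul_pos_right (a := ε) (by linarith) hε.le
  linarith

theorem density_right_pos (h : IsClassicalSolution 1 ε α β k ρ ρ' J) (hε : 0 < ε) (hα : 0 < α)
    (hβ : 0 < β) (hk : ∀ x ∈ Icc (0:ℝ) 1, 0 < k x) : 0 < ρ 1 := by
  have hJ := h.flux_pos hε hα hβ hk
  rw [h.flux_eq_right] at hJ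
  exact pos_of_mul_pos_right (pos_of_mul_pos_right hJ (hk 1 (by simp)).le) hβ.le

/-- A density below the repelling branch at `x₀` decreases at rate of order `1 / ε` until the
exit, which bounds its distance to that branch. -/
theorem mul_lt_of_density_le (h : IsClassicalSolution 1 ε α β k ρ ρ' J) (hε : 0 < ε)
    (hα : 0 < α) (hβ : 0 < β) (hk : ∀ x ∈ Icc (0:ℝ) 1, 0 < k x) (hanti : AntitoneOn k (Icc 0 1))
    {x₀ a c : ℝ} (hx₀ : x₀ ∈ Ico (0:ℝ) 1) (ha : a ≤ 1/2) (hρ : ρ x₀ ≤ a) (hc : 0 < c)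
    (hac : a * (1 - a) + c ≤ J / k x₀) : c * (1 - x₀) < 2 * ε * a := by
  have hJ := h.flux_pos hε hα hβ hk
  have hpos := h.density_right_pos hε hα hβ hk
  have hd : 0 < c / (2 * ε) := by positivity
  have hl := line_le_of_slope_lt_deriv (f := fun x => -ρ x) (f' := fun x => -ρ' x) (a := -a)
    (d := c / (2 * ε)) hx₀.1 hx₀.2.le le_rfl (fun x hx => (h.1 x hx).neg)
    (neg_le_neg hρ) fun x hx hxe => by
      have hxm : x ∈ Icc (0:ℝ) 1 := ⟨hx₀.1.trans hx.1, hx.2.le⟩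
      have he := h.mul_deriv_eq hk hxm
      have hJk : J / k x₀ ≤ J / k x := div_le_div_of_nonneg_left hJ.le (hk x hxm)
        (hanti (Ico_subset_Icc_self hx₀) hxm hx.1)
      have hxa : ρ x ≤ a := by
        have := mul_nonneg hd.le (sub_nonneg.2 hx.1)
        linarith
      have hq : ρ x * (1 - ρ x) ≤ a * (1 - a) := by nlinarith
      rw [div_lt_iff₀ (by positivity)]
      linarith
  have hlt : c / (2 * ε) * (1 - x₀) < a := by linarith
  rw [div_mul_eq_mul_div, div_lt_iff₀ (by positivity)] at hlt
  linarith

/-- A density between the branches is pushed up at rate of order `1 / ε`. -/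
theorem mul_lt_of_le_density (h : IsClassicalSolution 1 ε α β k ρ ρ' J) (hε : 0 < ε)
    (hα : 0 < α) (hβ : 0 < β) (hk : ∀ x ∈ Icc (0:ℝ) 1, 0 < k x) (hanti : AntitoneOn k (Icc 0 1))
    {x₀ x₁ a c m : ℝ} (hx₀ : 0 ≤ x₀) (hx : x₀ ≤ x₁) (hx₁ : x₁ ≤ 1) (hρ : a ≤ ρ x₀) (hc : 0 < c)
    (hm : ∀ x ∈ Icc (0:ℝ) 1, ρ x < m) (hac : J / k x₁ + c ≤ a * (1 - a))
    (hmc : J / k x₁ + c ≤ m * (1 - m)) : c * (x₁ - x₀) < 2 * ε * (m - a) := by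
  have hJ := h.flux_pos hε hα hβ hk
  have hd : 0 < c / (2 * ε) := by positivity
  have hx₁m : x₁ ∈ Icc (0:ℝ) 1 := ⟨hx₀.trans hx, hx₁⟩
  have hl := line_le_of_slope_lt_deriv (d := c / (2 * ε)) hx₀ hx hx₁ h.1 hρ fun x hx hxe => by
      have hxm : x ∈ Icc (0:ℝ) 1 := ⟨hx₀.trans hx.1, hx.2.le.trans hx₁⟩
      have he := h.mul_deriv_eq hk hxm
      have hJk : J / k x ≤ J / k x₁ := div_le_div_of_nonneg_left hJ.le (hk _ hx₁m)
        (hanti hxm hx₁m hx.2.le)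
      have hxa : a ≤ ρ x := by
        have := mul_nonneg hd.le (sub_nonneg.2 hx.1)
        linarith
      have hq : J / k x₁ + c ≤ ρ x * (1 - ρ x) := by
        have := hm x hxm
        rcases le_total (ρ x + a) 1 with h1 | h1 <;> nlinarith
      rw [div_lt_iff₀ (by positivity)]
      linarith
  have hlt : c / (2 * ε) * (x₁ - x₀) < m - a := by linarith [hm x₁ hx₁m]
  rw [div_mul_eq_mul_div, div_lt_iff₀ (by positivity)] at hlt
  linarith

/-- A level between the branches that exceeds the exit density exceeds the density everywhere. -/
theorem density_lt (h : IsClassicalSolution 1 ε α β k ρ ρ' J) (hε : 0 < ε)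
    (hα : 0 < α) (hβ : 0 < β) (hk : ∀ x ∈ Icc (0:ℝ) 1, 0 < k x) (hanti : AntitoneOn k (Icc 0 1))
    {m : ℝ} (hJm : J < k 1 * (β * m)) (hJm' : J / k 1 < m * (1 - m)) :
    ∀ x ∈ Icc (0:ℝ) 1, ρ x < m := by
  intro x₀ hx₀
  by_contra! hρ
  have hJ := h.flux_pos hε hα hβ hk
  have h1 := hk 1 (by simp)
  have hl := line_le_of_slope_lt_deriv (d := 0) hx₀.1 hx₀.2 le_rfl h.1 hρ fun x hx hxe => by
    have hxm : x ∈ Icc (0:ℝ) 1 := ⟨hx₀.1.trans hx.1, hx.2.le⟩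
    have he := h.mul_deriv_eq hk hxm
    have hJk : J / k x ≤ J / k 1 := div_le_div_of_nonneg_left hJ.le h1
      (hanti hxm (by simp) hxm.2)
    have hxe' : ρ x = m := by linarith
    rw [hxe'] at he
    exact pos_of_mul_pos_right (a := ε) (by linarith) hε.le
  rw [h.flux_eq_right] at hJm
  have := lt_of_mul_lt_mul_left (lt_of_mul_lt_mul_left hJm h1.le) hβ.le
  linarith

end IsClassicalSolution

theorem eventually_mul_lt (C : ℝ) {c : ℝ} (hc : 0 < c) :
    ∀ᶠ ε in nhdsWithin (0:ℝ) (Ioi 0), 2 * ε * C < c := by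
  have h : Tendsto (fun ε : ℝ => 2 * ε * C) (nhdsWithin 0 (Ioi 0)) (nhds (2 * 0 * C)) :=
    (by fun_prop : Continuous fun ε : ℝ => 2 * ε * C).tendsto 0 |>.mono_left nhdsWithin_le_nhds
  exact h.eventually_lt_const (by simpa using hc)

/-- Vanishing-viscosity pointwise limit of the density in region G₁ ∪ G₂:
away from the exit the profile follows the repelling branch of the critical manifold. -/
theorem vanishing_viscosity_region12_interior
    (α β : ℝ) (k k' : ℝ → ℝ) (ρ ρ' : ℝ → ℝ → ℝ) (J : ℝ → ℝ)
    (hk : ∀ x ∈ Icc (0:ℝ) 1, HasDerivWithinAt k (k' x) (Icc 0 1) x)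
    (hk'c : ContinuousOn k' (Icc 0 1))
    (hkpos : ∀ x ∈ Icc (0:ℝ) 1, 0 < k x)
    (hk'neg : ∀ x ∈ Icc (0:ℝ) 1, k' x < 0)
    (hα0 : 0 < α) (hαf : α < rhoF k)
    (hβ1 : rhoStar α k < β) (hβ2 : β < 1) (hβne : β ≠ 1 - rhoStar α k)
    (hsol : ∀ ε > 0, IsClassicalSolution 1 ε α β k (ρ ε) (ρ' ε) (J ε)) :
    ∀ x ∈ Ico (0:ℝ) 1,
      Tendsto (fun ε => ρ ε x) (nhdsWithin 0 (Ioi 0))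
        (nhds ((1/2) * (1 - Real.sqrt (1 - 4*α*(1-α) * k 0 / k x)))) := by
  have hanti := antitoneOn_of_hasDerivWithinAt_neg hk hk'neg
  have hkc : ContinuousOn k (Icc 0 1) := fun x hx => (hk x hx).continuousWithinAt
  have h0 : 0 < k 0 := hkpos 0 (by simp)
  have h1 : 0 < k 1 := hkpos 1 (by simp)
  have hα2 : α < 1/2 := hαf.trans_le <| by
    unfold rhoF; linarith [Real.sqrt_nonneg (1 - k 1 / k 0)]
  set S : ℝ := α * (1 - α) * k 0 with hS
  have hS0 : 0 < S := mul_pos (mul_pos hα0 (by linarith)) h0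
  have hS1 : 4 * S < k 1 := by
    have := four_mul_lt_of_lt_rhoF h0 hαf
    rw [hS]; linarith
  set r : ℝ → ℝ := fun x => (1/2) * (1 - √(1 - 4*α*(1-α) * k 0 / k x)) with hr
  have hrS : ∀ x, r x = (1/2) * (1 - √(1 - 4 * (S / k x))) := fun x => by
    simp only [hr, hS]; congr 4; ring
  have hSk : ∀ x ∈ Icc (0:ℝ) 1, 4 * (S / k x) < 1 := fun x hx => by
    have := hanti hx (right_mem_Icc.2 zero_le_one) hx.2
    rw [← mul_div_assoc, div_lt_one (hkpos x hx)]
    linarith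
  have hrr : ∀ x ∈ Icc (0:ℝ) 1, r x * (1 - r x) = S / k x := fun x hx => by
    rw [hrS]; exact mul_one_sub_half_sub_sqrt (hSk x hx).le
  have hr2 : ∀ x ∈ Icc (0:ℝ) 1, r x < 1/2 := fun x hx => by
    have := Real.sqrt_pos.2 (sub_pos.2 (hSk x hx))
    rw [hrS]; linarith
  have hr0 : r 0 = α := by
    have e0 := hrr 0 (by simp)
    rw [hS, mul_div_cancel_right₀ _ h0.ne'] at e0
    have e2 : (r 0 - α) * (1 - α - r 0) = 0 := by linear_combination e0
    have := hr2 0 (by simp)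
    rcases mul_eq_zero.1 e2 with e | e <;> linarith
  have hq1 := hrr 1 (by simp)
  have hq2 := hr2 1 (by simp)
  have hqβ : r 1 < β := hβ1
  have hq0 : 0 < r 1 := by
    have : 0 < r 1 * (1 - r 1) := hq1 ▸ div_pos hS0 h1
    exact pos_of_mul_pos_left this (by linarith)
  have hβ0 : 0 < β := hq0.trans hqβ
  -- a level above the limiting exit density and below the attracting branch
  obtain ⟨m, hm2, hSm, hSm'⟩ : ∃ m, 1/2 ≤ m ∧ S < k 1 * (β * m) ∧ S / k 1 < m * (1 - m) := by
    have hlt : max (1/2) (r 1 * (1 - r 1) / β) < 1 - r 1 := by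
      refine max_lt (by linarith) ?_
      rw [div_lt_iff₀ hβ0]
      nlinarith
    obtain ⟨m, hm, hm'⟩ := exists_between hlt
    obtain ⟨hma, hmb⟩ := max_lt_iff.1 hm
    rw [hq1, div_lt_iff₀ hβ0, div_lt_iff₀ h1] at hmb
    refine ⟨m, hma.le, by linarith, ?_⟩
    rw [← hq1]
    nlinarith
  have hpos : ∀ᶠ ε in nhdsWithin (0:ℝ) (Ioi 0), 0 < ε := self_mem_nhdsWithin
  have hJub : ∀ S', S < S' → ∀ᶠ ε in nhdsWithin (0:ℝ) (Ioi 0), J ε < S' := by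
    intro S' hS'
    have hc : 0 < (S' - S) / k 0 := div_pos (sub_pos.2 hS') h0
    filter_upwards [hpos, eventually_mul_lt α hc] with ε hε hεc
    by_contra! hJ
    have hl := (hsol ε hε).flux_eq_left
    have hρ : ρ ε 0 ≤ α := by
      have : (k 0 * α) * (1 - α) ≤ (k 0 * α) * (1 - ρ ε 0) := by linarith
      linarith [le_of_mul_le_mul_left this (mul_pos h0 hα0)]
    have := (hsol ε hε).mul_lt_of_density_le hε hα0 hβ0 hkpos hanti (x₀ := 0) (by simp) hα2.le hρ
      hc (by
        have e : α * (1 - α) = S / k 0 := by rw [hS, mul_div_cancel_right₀ _ h0.ne']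
        rw [e, ← add_div]
        gcongr
        linarith)
    linarith
  have hρm : ∀ᶠ ε in nhdsWithin (0:ℝ) (Ioi 0), ∀ x ∈ Icc (0:ℝ) 1, ρ ε x < m := by
    rw [div_lt_iff₀ h1] at hSm'
    filter_upwards [hpos, hJub _ hSm, hJub _ hSm'] with ε hε hJ hJ'
    exact (hsol ε hε).density_lt hε hα0 hβ0 hkpos hanti hJ ((div_lt_iff₀ h1).2 hJ')
  have hρub : ∀ x₀ ∈ Ico (0:ℝ) 1, ∀ b, r x₀ < b →
      ∀ᶠ ε in nhdsWithin (0:ℝ) (Ioi 0), ρ ε x₀ < b := by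
    intro x₀ hx₀ b hb
    have hx₀m := Ico_subset_Icc_self hx₀
    obtain ⟨a, hra, hab⟩ := exists_between (lt_min hb (hr2 x₀ hx₀m))
    obtain ⟨hab, ha2⟩ := lt_min_iff.1 hab
    have hSa : S / k x₀ < a * (1 - a) := by
      rw [← hrr x₀ hx₀m]; nlinarith
    obtain ⟨x₁, hx₁a, hx₁⟩ : ∃ x₁, S / k x₁ < a * (1 - a) ∧ x₁ ∈ Ioo x₀ 1 := by
      have hc : Tendsto (fun x => S / k x) (nhdsWithin x₀ (Ioi x₀)) (nhds (S / k x₀)) := by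
        refine tendsto_const_nhds.div ?_ (hkpos x₀ hx₀m).ne'
        exact ((hkc x₀ hx₀m).mono_of_mem_nhdsWithin (Icc_mem_nhdsGT_of_mem hx₀))
      exact ((hc.eventually_lt_const hSa).and (Ioo_mem_nhdsGT hx₀.2)).exists
    have hx₁m : x₁ ∈ Icc (0:ℝ) 1 := ⟨hx₀.1.trans hx₁.1.le, hx₁.2.le⟩
    have hk₁ := hkpos x₁ hx₁m
    have hx₁m' : S / k x₁ < m * (1 - m) := lt_of_le_of_lt
      (div_le_div_of_nonneg_left hS0.le h1 (hanti hx₁m (by simp) hx₁.2.le)) hSm'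
    obtain ⟨t, ht, ht'⟩ := exists_between (lt_min hx₁a hx₁m')
    obtain ⟨hta, htm⟩ := lt_min_iff.1 ht'
    obtain ⟨c, hc, hc'⟩ := exists_between (lt_min (sub_pos.2 hta) (sub_pos.2 htm))
    obtain ⟨hca, hcm⟩ := lt_min_iff.1 hc'
    filter_upwards [hpos, hρm, hJub _ ((div_lt_iff₀ hk₁).1 ht),
      eventually_mul_lt (m - a) (mul_pos hc (sub_pos.2 hx₁.1))] with ε hε hm hJ hεc
    rw [← div_lt_iff₀ hk₁] at hJ
    by_contra! hρ
    have := (hsol ε hε).mul_lt_of_le_density hε hα0 hβ0 hkpos hanti hx₀.1 hx₁.1.le hx₁.2.le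
      (hab.le.trans hρ) hc hm (by linarith) (by linarith)
    linarith
  have hJlb : ∀ S', S' < S → ∀ᶠ ε in nhdsWithin (0:ℝ) (Ioi 0), S' < J ε := by
    intro S' hS'
    have hkα := mul_pos h0 hα0
    filter_upwards [hpos, hρub 0 (by simp) (1 - S' / (k 0 * α)) (by
      rw [hr0, lt_sub_comm, div_lt_iff₀ hkα]; linarith)] with ε hε hρ
    rw [lt_sub_comm, div_lt_iff₀ hkα] at hρ
    linarith [(hsol ε hε).flux_eq_left]
  intro x₀ hx₀
  have hx₀m := Ico_subset_Icc_self hx₀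
  have hk₀ := hkpos x₀ hx₀m
  refine tendsto_order.2 ⟨fun a ha => ?_, hρub x₀ hx₀⟩
  have ha2 : a < 1/2 := ha.trans (hr2 x₀ hx₀m)
  have hra : a < r x₀ := ha
  have hSa : a * (1 - a) < S / k x₀ := by
    have := hr2 x₀ hx₀m
    rw [← hrr x₀ hx₀m]; nlinarith
  obtain ⟨t, hta, ht⟩ := exists_between hSa
  filter_upwards [hpos, hJlb _ ((lt_div_iff₀ hk₀).1 ht),
    eventually_mul_lt a (mul_pos (sub_pos.2 hta) (sub_pos.2 hx₀.2))] with ε hε hJ hεc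
  by_contra! hρ
  rw [← lt_div_iff₀ hk₀] at hJ
  have := (hsol ε hε).mul_lt_of_density_le hε hα0 hβ0 hkpos hanti hx₀ ha2.le hρ (sub_pos.2 hta)
    (by linarith)
  linarith
end

section
/- Assume 0 < β < 1/2, α > 1 − ρ_*(β) and α ≠ ρ_*(β). Suppose that for every ε > 0, (ρ_ε, J_ε) is a classical solution of the area-averaged pedestrian boundary value problem on [0,1] with diffusion ε. Then for every fixed x ∈ (0,1], ρ_ε(x) → (1/2)·(1 + √(1 − 4β(1−β)·k(1)/k(x))) as ε → 0⁺. -/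
open Set Filter

/-- A barrier argument: a function that decreases strictly whenever it meets the level `c`
cannot cross it upwards. -/
theorem le_of_deriv_neg_at_level {f f' : ℝ → ℝ} {a b c : ℝ}
    (hf : ∀ t ∈ Icc a b, HasDerivWithinAt f (f' t) (Icc a b) t)
    (ha : f a ≤ c) (hc : ∀ t ∈ Icc a b, f t = c → f' t < 0) :
    ∀ t ∈ Icc a b, f t ≤ c := by
  intro t ht
  refine image_le_of_deriv_right_lt_deriv_boundary' (f := f) (f' := f') (B := fun _ => c)
    (B' := fun _ => 0) (fun s hs => (hf s hs).continuousWithinAt) ?_ ha continuousOn_const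
    (fun s _ => hasDerivWithinAt_const _ _ _) (fun s hs h => hc s (Ico_subset_Icc_self hs) h) ht
  intro s hs
  exact (hf s (Ico_subset_Icc_self hs)).mono_of_mem_nhdsWithin (Icc_mem_nhdsGE_of_mem hs)

theorem ge_of_deriv_pos_at_level {f f' : ℝ → ℝ} {a b c : ℝ}
    (hf : ∀ t ∈ Icc a b, HasDerivWithinAt f (f' t) (Icc a b) t)
    (ha : c ≤ f a) (hc : ∀ t ∈ Icc a b, f t = c → 0 < f' t) :
    ∀ t ∈ Icc a b, c ≤ f t := by
  intro t ht
  have := le_of_deriv_neg_at_level (f := fun s => -f s) (f' := fun s => -f' s) (c := -c)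
    (fun s hs => (hf s hs).fun_neg) (by simpa using ha)
    (fun s hs h => by simpa using hc s hs (by linarith)) t ht
  linarith

theorem hasDerivWithinAt_reflect {f f' : ℝ → ℝ} {a b : ℝ}
    (hf : ∀ t ∈ Icc a b, HasDerivWithinAt f (f' t) (Icc a b) t) :
    ∀ t ∈ Icc a b, HasDerivWithinAt (fun s => f (a + b - s)) (-f' (a + b - t)) (Icc a b) t := by
  intro t ht
  have hmap : MapsTo (fun s => a + b - s) (Icc a b) (Icc a b) := fun s hs =>
    ⟨by linarith [hs.2], by linarith [hs.1]⟩
  have h := (hf _ (hmap ht)).scomp t ((hasDerivWithinAt_id t (Icc a b)).const_sub (a + b)) hmap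
  simpa [Function.comp_def] using h

theorem le_of_deriv_pos_at_level_of_right {f f' : ℝ → ℝ} {a b c : ℝ}
    (hf : ∀ t ∈ Icc a b, HasDerivWithinAt f (f' t) (Icc a b) t)
    (hb : f b ≤ c) (hc : ∀ t ∈ Icc a b, f t = c → 0 < f' t) :
    ∀ t ∈ Icc a b, f t ≤ c := by
  intro t ht
  have hmap : ∀ s ∈ Icc a b, a + b - s ∈ Icc a b := fun s hs =>
    ⟨by linarith [hs.2], by linarith [hs.1]⟩
  have := le_of_deriv_neg_at_level (hasDerivWithinAt_reflect hf) (c := c) (by simpa using hb)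
    (fun s hs h => by simpa using hc _ (hmap s hs) h) _ (hmap t ht)
  simpa using this

theorem ge_of_deriv_neg_at_level_of_right {f f' : ℝ → ℝ} {a b c : ℝ}
    (hf : ∀ t ∈ Icc a b, HasDerivWithinAt f (f' t) (Icc a b) t)
    (hb : c ≤ f b) (hc : ∀ t ∈ Icc a b, f t = c → f' t < 0) :
    ∀ t ∈ Icc a b, c ≤ f t := by
  intro t ht
  have hmap : ∀ s ∈ Icc a b, a + b - s ∈ Icc a b := fun s hs =>
    ⟨by linarith [hs.2], by linarith [hs.1]⟩
  have := ge_of_deriv_pos_at_level (hasDerivWithinAt_reflect hf) (c := c) (by simpa using hb)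
    (fun s hs h => by simpa using hc _ (hmap s hs) h) _ (hmap t ht)
  simpa using this

theorem mul_sub_le_sub_of_le_deriv {f f' : ℝ → ℝ} {a b m : ℝ} (hab : a ≤ b)
    (hf : ∀ t ∈ Icc a b, HasDerivWithinAt f (f' t) (Icc a b) t)
    (hm : ∀ t ∈ Icc a b, m ≤ f' t) : m * (b - a) ≤ f b - f a := by
  have h := image_le_of_deriv_right_le_deriv_boundary (f := fun t => m * (t - a))
    (f' := fun _ => m) (B := fun t => f t - f a) (B' := f') (a := a) (b := b)
    (by fun_prop) (fun s _ => ?_) (by simp)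
    (fun s hs => ((hf s hs).sub_const _).continuousWithinAt) (fun s hs => ?_)
    (fun s hs => hm s (Ico_subset_Icc_self hs)) (right_mem_Icc.2 hab)
  · exact h
  · simpa using (((hasDerivAt_id s).sub_const a).const_mul m).hasDerivWithinAt
  · exact ((hf s (Ico_subset_Icc_self hs)).mono_of_mem_nhdsWithin
      (Icc_mem_nhdsGE_of_mem hs)).sub_const _

/-- The boundary value problem with the flux equation solved for the derivative;
`w` stands for the reciprocal of the width. -/
structure IsReducedSolution (ε α β : ℝ) (w ρ ρ' : ℝ → ℝ) (J : ℝ) : Prop where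
  deriv : ∀ t ∈ Icc (0:ℝ) 1, HasDerivWithinAt ρ (ρ' t) (Icc 0 1) t
  eqn : ∀ t ∈ Icc (0:ℝ) 1, ε * ρ' t = ρ t * (1 - ρ t) - J * w t
  inflow : J * w 0 = α * (1 - ρ 0)
  outflow : J * w 1 = β * ρ 1

theorem IsClassicalSolution.isReducedSolution {ε α β J : ℝ} {k ρ ρ' : ℝ → ℝ}
    (hk : ∀ x ∈ Icc (0:ℝ) 1, 0 < k x) (h : IsClassicalSolution 1 ε α β k ρ ρ' J) :
    IsReducedSolution ε α β (fun x => (k x)⁻¹) ρ ρ' J := by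
  obtain ⟨h1, -, h3, h4, h5⟩ := h
  have key : ∀ t ∈ Icc (0:ℝ) 1, -ε * ρ' t + ρ t * (1 - ρ t) = J * (k t)⁻¹ := by
    intro t ht
    rw [← h3 t ht]
    field_simp [(hk t ht).ne']
  refine ⟨h1, fun t ht => ?_, ?_, ?_⟩
  · linarith [key t ht]
  · rw [← h4, key 0 (by simp)]
  · rw [← h5, key 1 (by simp)]

namespace IsReducedSolution

variable {ε α β J : ℝ} {w ρ ρ' : ℝ → ℝ}

theorem deriv_sub (h : IsReducedSolution ε α β w ρ ρ' J) {a b : ℝ} (ha : 0 ≤ a) (hb : b ≤ 1) :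
    ∀ t ∈ Icc a b, HasDerivWithinAt ρ (ρ' t) (Icc a b) t := fun t ht =>
  (h.deriv t ⟨ha.trans ht.1, ht.2.trans hb⟩).mono (Icc_subset_Icc ha hb)

theorem flux_pos (h : IsReducedSolution ε α β w ρ ρ' J) (hε : 0 < ε) (hα : 0 < α) (hβ : 0 < β)
    (hw : ∀ t ∈ Icc (0:ℝ) 1, 0 < w t) : 0 < J := by
  by_contra! hJ
  have hJw : ∀ t ∈ Icc (0:ℝ) 1, J * w t ≤ 0 := fun t ht =>
    mul_nonpos_of_nonpos_of_nonneg hJ (hw t ht).le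
  have h0 : 1 ≤ ρ 0 := by nlinarith [hJw 0 (by simp), h.inflow]
  have h1 : ρ 1 ≤ 0 := by nlinarith [hJw 1 (by simp), h.outflow]
  have := ge_of_deriv_pos_at_level h.deriv (c := 1/2) (by linarith) (fun t ht hρ => by
    have e := h.eqn t ht
    rw [hρ] at e
    exact pos_of_mul_pos_right (by linarith [hJw t ht] : 0 < ε * ρ' t) hε.le) 1 (by simp)
  linarith

theorem mem_Icc (h : IsReducedSolution ε α β w ρ ρ' J) (hε : 0 < ε) (hα : 0 < α) (hβ : 0 < β)
    (hw : ∀ t ∈ Icc (0:ℝ) 1, 0 < w t) : ∀ t ∈ Icc (0:ℝ) 1, ρ t ∈ Icc (0:ℝ) 1 := by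
  have hJ := h.flux_pos hε hα hβ hw
  have hJw : ∀ t ∈ Icc (0:ℝ) 1, 0 < J * w t := fun t ht => mul_pos hJ (hw t ht)
  have hneg : ∀ t ∈ Icc (0:ℝ) 1, ρ t * (1 - ρ t) = 0 → ρ' t < 0 := by
    intro t ht h0
    have e := h.eqn t ht
    have := hJw t ht
    exact neg_of_mul_neg_right (by linarith : ε * ρ' t < 0) hε.le
  intro t ht
  constructor
  · refine ge_of_deriv_neg_at_level_of_right h.deriv ?_ (fun s hs e => hneg s hs (by simp [e])) t ht
    nlinarith [hJw 1 (by simp), h.outflow]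
  · refine le_of_deriv_neg_at_level h.deriv ?_ (fun s hs e => hneg s hs (by simp [e])) t ht
    nlinarith [hJw 0 (by simp), h.inflow]

theorem flux_mul_le (h : IsReducedSolution ε α β w ρ ρ' J) (hε : 0 < ε) (hα : 0 < α) (hβ : 0 < β)
    (hα1 : α < 1) (hw : ∀ t ∈ Icc (0:ℝ) 1, 0 < w t) : J * w 0 ≤ 1 := by
  have := h.mem_Icc hε hα hβ hw 0 (by simp)
  rw [h.inflow]
  nlinarith [this.1, this.2]

/-- A density above the level `p` at `x` forces `p * (1 - p)` to be almost as large as the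
local flux, because otherwise the profile would blow up to the left of `x`. -/
theorem eventually_flux_le {x p κ : ℝ} (hα : 0 < α) (hβ : 0 < β) (hα1 : α < 1)
    (hw : ∀ t ∈ Icc (0:ℝ) 1, 0 < w t) (hwc : ContinuousOn w (Icc 0 1))
    (hx : x ∈ Ioc (0:ℝ) 1) (hp : 1 / 2 ≤ p) (hκ : 0 < κ) :
    ∃ ε₀ > 0, ∀ ε ρ ρ' J, 0 < ε → ε < ε₀ → IsReducedSolution ε α β w ρ ρ' J → p ≤ ρ x →
      J * w x ≤ p * (1 - p) + κ := by
  have hw0 := hw 0 (by simp)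
  have hxI : x ∈ Icc (0:ℝ) 1 := ⟨hx.1.le, hx.2⟩
  obtain ⟨δ, hδ, hδw⟩ := Metric.continuousOn_iff.1 hwc x hxI (κ * w 0 / 2) (by positivity)
  set d := min (δ / 2) x with hd
  have hd0 : 0 < d := lt_min (by linarith) hx.1
  have hdx : d ≤ x := min_le_right _ _
  have hdδ : d < δ := (min_le_left _ _).trans_lt (by linarith)
  refine ⟨κ / 2 * d, by positivity, fun ε ρ ρ' J hε hεs h hpx => ?_⟩
  by_contra! hcon
  have hJ := h.flux_pos hε hα hβ hw
  have hJ1 := h.flux_mul_le hε hα hβ hα1 hw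
  have hsub : ∀ t ∈ Icc (x - d) x, t ∈ Icc (0:ℝ) 1 := fun t ht =>
    ⟨by linarith [ht.1], ht.2.trans hx.2⟩
  have hflux : ∀ t ∈ Icc (x - d) x, p * (1 - p) + κ / 2 ≤ J * w t := by
    intro t ht
    have h1 := hδw t (hsub t ht) (by
      rw [Real.dist_eq, abs_lt]; constructor <;> linarith [ht.1, ht.2])
    rw [Real.dist_eq, abs_lt] at h1
    nlinarith [mul_lt_mul_of_pos_left h1.1 hJ]
  have hder := h.deriv_sub (a := x - d) (b := x) (by linarith) hx.2
  have hge := ge_of_deriv_neg_at_level_of_right hder hpx (fun t ht e => by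
    have e1 := h.eqn t (hsub t ht)
    rw [e] at e1
    exact neg_of_mul_neg_right (by linarith [hflux t ht] : ε * ρ' t < 0) hε.le)
  have hmv := mul_sub_le_sub_of_le_deriv (f := fun t => -(ε * ρ t)) (f' := fun t => -(ε * ρ' t))
    (m := κ / 2) (by linarith : x - d ≤ x) (fun t ht => ((hder t ht).const_mul ε).fun_neg)
    (fun t ht => by
      have := hge t ht
      rw [h.eqn t (hsub t ht)]
      nlinarith [hflux t ht, mul_nonneg (sub_nonneg.2 this) (by linarith : 0 ≤ ρ t + p - 1)])
  have b1 := h.mem_Icc hε hα hβ hw x hxI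
  have b2 := h.mem_Icc hε hα hβ hw (x - d) (hsub _ ⟨le_rfl, by linarith⟩)
  nlinarith [b1.1, b2.2]

set_option maxHeartbeats 1000000 in
/-- If the density at `x` lies below a level `P ≥ 1/2` that is strictly below the attracting
branch, then the entrance density is close to `α`. -/
theorem eventually_entrance_near {x P κ η : ℝ} (hα : 0 < α) (hβ : 0 < β) (hα1 : α < 1)
    (hw : ∀ t ∈ Icc (0:ℝ) 1, 0 < w t) (hwc : ContinuousOn w (Icc 0 1))
    (hwm : MonotoneOn w (Icc 0 1))
    (hx : x ∈ Ioc (0:ℝ) 1) (hP : 1 / 2 ≤ P) (hP1 : P < 1) (hκ : 0 < κ) (hη : 0 < η) :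
    ∃ ε₀ > 0, ∀ ε ρ ρ' J, 0 < ε → ε < ε₀ → IsReducedSolution ε α β w ρ ρ' J → ρ x ≤ P →
      J * w x + κ ≤ P * (1 - P) → ρ 0 ≤ P ∧ α - η < ρ 0 ∧ ρ 0 < α + η := by
  have hw0 := hw 0 (by simp)
  have hxI : x ∈ Icc (0:ℝ) 1 := ⟨hx.1.le, hx.2⟩
  have h0I : (0:ℝ) ∈ Icc (0:ℝ) 1 := by simp
  have hQ : 0 < 1 - P := by linarith
  set μ := (1 - P) * η / 2 with hμdef
  have hμ : 0 < μ := by positivity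
  obtain ⟨δ, hδ, hδw⟩ := Metric.continuousOn_iff.1 hwc 0 h0I (μ * w 0) (by positivity)
  set d := min (δ / 2) x with hd
  have hd0 : 0 < d := lt_min (by linarith) hx.1
  have hdx : d ≤ x := min_le_right _ _
  have hdδ : d < δ := (min_le_left _ _).trans_lt (by linarith)
  set m := min κ μ with hm
  have hm0 : 0 < m := lt_min hκ hμ
  have hmκ : m ≤ κ := min_le_left _ _
  have hmμ : m ≤ μ := min_le_right _ _
  refine ⟨min (m * d) μ, lt_min (by positivity) hμ, fun ε ρ ρ' J hε hεs h hρx hPx => ?_⟩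
  have hε1 : ε < m * d := hεs.trans_le (min_le_left _ _)
  have hε2 : ε < μ := hεs.trans_le (min_le_right _ _)
  have hJ := h.flux_pos hε hα hβ hw
  have hJ1 := h.flux_mul_le hε hα hβ hα1 hw
  have hbd := h.mem_Icc hε hα hβ hw
  have hsub : ∀ t ∈ Icc 0 x, t ∈ Icc (0:ℝ) 1 := fun t ht => ⟨ht.1, ht.2.trans hx.2⟩
  have hfluxle : ∀ t ∈ Icc 0 x, J * w t + κ ≤ P * (1 - P) := fun t ht => by
    nlinarith [mul_le_mul_of_nonneg_left (hwm (hsub t ht) hxI ht.2) hJ.le]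
  have hle := le_of_deriv_pos_at_level_of_right (h.deriv_sub le_rfl hx.2) hρx (fun t ht e => by
    have e1 := h.eqn t (hsub t ht)
    rw [e] at e1
    exact pos_of_mul_pos_right (by linarith [hfluxle t ht] : 0 < ε * ρ' t) hε.le)
  have hy := hle 0 ⟨le_rfl, hx.1.le⟩
  have hin := h.inflow
  refine ⟨hy, ?_, ?_⟩
  · by_contra! hcon
    have hgap : ρ 0 * (1 - ρ 0) + μ ≤ J * w 0 := by
      rw [hin]
      nlinarith [mul_le_mul (by linarith : 1 - P ≤ 1 - ρ 0) (by linarith : η ≤ α - ρ 0) hη.le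
        (by linarith)]
    have hhalf : ρ 0 < 1 / 2 := by
      by_contra! h2
      nlinarith [hfluxle 0 ⟨le_rfl, hx.1.le⟩,
        mul_nonneg (sub_nonneg.2 hy) (by linarith : 0 ≤ ρ 0 + P - 1)]
    have hmono : ∀ t ∈ Icc (0:ℝ) 1, ρ 0 * (1 - ρ 0) + μ ≤ J * w t := fun t ht => by
      nlinarith [mul_le_mul_of_nonneg_left (hwm h0I ht ht.1) hJ.le]
    have hup := le_of_deriv_neg_at_level h.deriv (le_refl (ρ 0)) (fun t ht e => by
      have e1 := h.eqn t ht
      rw [e] at e1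
      exact neg_of_mul_neg_right (by linarith [hmono t ht] : ε * ρ' t < 0) hε.le)
    have hmv := mul_sub_le_sub_of_le_deriv (f := fun t => -(ε * ρ t))
      (f' := fun t => -(ε * ρ' t)) (m := μ) (zero_le_one' ℝ)
      (fun t ht => ((h.deriv t ht).const_mul ε).fun_neg) (fun t ht => by
        rw [h.eqn t ht]
        nlinarith [hmono t ht, hup t ht,
          mul_nonneg (sub_nonneg.2 (hup t ht)) (by linarith [hup t ht] : 0 ≤ 1 - ρ 0 - ρ t)])
    nlinarith [(hbd 0 h0I).2, (hbd 1 (by simp)).1]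
  · by_contra! hcon
    have hgap : J * w 0 + 2 * μ ≤ ρ 0 * (1 - ρ 0) := by
      rw [hin]
      nlinarith [mul_le_mul (by linarith : 1 - P ≤ 1 - ρ 0) (by linarith : η ≤ ρ 0 - α) hη.le
        (by linarith)]
    have hsub' : ∀ t ∈ Icc 0 d, t ∈ Icc 0 x := fun t ht => ⟨ht.1, ht.2.trans hdx⟩
    have hflux : ∀ t ∈ Icc 0 d, J * w t + μ ≤ ρ 0 * (1 - ρ 0) := by
      intro t ht
      have h1 := hδw t (hsub t (hsub' t ht)) (by
        rw [Real.dist_eq, abs_lt]; constructor <;> linarith [ht.1, ht.2])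
      rw [Real.dist_eq, abs_lt] at h1
      nlinarith [mul_lt_mul_of_pos_left h1.2 hJ]
    have hder := h.deriv_sub (a := 0) (b := d) le_rfl (hdx.trans hx.2)
    have hlow := ge_of_deriv_pos_at_level hder (le_refl (ρ 0)) (fun t ht e => by
      have e1 := h.eqn t (hsub t (hsub' t ht))
      rw [e] at e1
      exact pos_of_mul_pos_right (by linarith [hflux t ht] : 0 < ε * ρ' t) hε.le)
    have hmv := mul_sub_le_sub_of_le_deriv (f := fun t => ε * ρ t)
      (f' := fun t => ε * ρ' t) (m := m) hd0.le
      (fun t ht => (hder t ht).const_mul ε) (fun t ht => by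
        rw [h.eqn t (hsub t (hsub' t ht))]
        have a1 := hlow t ht
        have a2 := hle t (hsub' t ht)
        have a3 := hflux t ht
        have a4 := hfluxle t (hsub' t ht)
        rcases le_total (ρ t + ρ 0) 1 with h1 | h1
        · have := mul_nonneg (sub_nonneg.2 a1) (sub_nonneg.2 h1)
          have e : (ρ t - ρ 0) * (1 - (ρ t + ρ 0)) = ρ t * (1 - ρ t) - ρ 0 * (1 - ρ 0) := by ring
          linarith
        · have := mul_nonneg (sub_nonneg.2 a2) (by linarith : 0 ≤ ρ t + P - 1)
          have e : (P - ρ t) * (ρ t + P - 1) = ρ t * (1 - ρ t) - P * (1 - P) := by ring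
          linarith)
    have b0 := (hbd 0 h0I).1
    have bd := (hbd d (hsub d (hsub' d ⟨hd0.le, le_rfl⟩))).2
    have e : ε * (ρ d - ρ 0) ≤ ε := mul_le_of_le_one_right hε.le (by linarith)
    rw [mul_sub] at e
    linarith

end IsReducedSolution

set_option maxHeartbeats 1000000 in
/-- Vanishing-viscosity pointwise limit of the density in region G₅ ∪ G₆:
away from the entrance the profile follows the attracting branch of the critical manifold. -/
theorem vanishing_viscosity_region56_interior
    (α β : ℝ) (k k' : ℝ → ℝ) (ρ ρ' : ℝ → ℝ → ℝ) (J : ℝ → ℝ)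
    (hk : ∀ x ∈ Icc (0:ℝ) 1, HasDerivWithinAt k (k' x) (Icc 0 1) x)
    (hk'c : ContinuousOn k' (Icc 0 1))
    (hkpos : ∀ x ∈ Icc (0:ℝ) 1, 0 < k x)
    (hk'neg : ∀ x ∈ Icc (0:ℝ) 1, k' x < 0)
    (hβ0 : 0 < β) (hβ1 : β < 1/2)
    (hα0 : 1 - rhoStarLow β k < α) (hα1 : α < 1) (hαne : α ≠ rhoStarLow β k)
    (hsol : ∀ ε > 0, IsClassicalSolution 1 ε α β k (ρ ε) (ρ' ε) (J ε)) :
    ∀ x ∈ Ioc (0:ℝ) 1,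
      Tendsto (fun ε => ρ ε x) (nhdsWithin 0 (Ioi 0))
        (nhds ((1/2) * (1 + Real.sqrt (1 - 4*β*(1-β) * k 1 / k x)))) := by
  intro x hx
  obtain ⟨w, hwdef⟩ : ∃ w : ℝ → ℝ, w = fun t => (k t)⁻¹ := ⟨_, rfl⟩
  have h0I : (0:ℝ) ∈ Icc (0:ℝ) 1 := by simp
  have h1I : (1:ℝ) ∈ Icc (0:ℝ) 1 := by simp
  have hxI : x ∈ Icc (0:ℝ) 1 := ⟨hx.1.le, hx.2⟩
  have hkc : ContinuousOn k (Icc 0 1) := fun t ht => (hk t ht).continuousWithinAt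
  have hkanti : AntitoneOn k (Icc 0 1) := by
    refine antitoneOn_of_hasDerivWithinAt_nonpos (f' := k') (convex_Icc 0 1) hkc
      (fun t ht => (hk t (interior_subset ht)).mono interior_subset)
      (fun t ht => (hk'neg t (interior_subset ht)).le)
  have hw : ∀ t ∈ Icc (0:ℝ) 1, 0 < w t := fun t ht => by
    rw [hwdef]; exact inv_pos.2 (hkpos t ht)
  have hwc : ContinuousOn w (Icc 0 1) := by
    rw [hwdef]; exact hkc.inv₀ fun t ht => (hkpos t ht).ne'
  have hwm : MonotoneOn w (Icc 0 1) := fun a ha b hb hab => by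
    rw [hwdef]; exact inv_anti₀ (hkpos b hb) (hkanti ha hb hab)
  have hred : ∀ ε > 0, IsReducedSolution ε α β w (ρ ε) (ρ' ε) (J ε) := fun ε hε => by
    rw [hwdef]; exact (hsol ε hε).isReducedSolution hkpos
  have hw01 : w 0 ≤ w 1 := hwm h0I h1I zero_le_one
  have hw0x : w 0 ≤ w x := hwm h0I hxI hx.1.le
  have hwx1 : w x ≤ w 1 := hwm hxI h1I hx.2
  have hw0 := hw 0 h0I
  have hw1 := hw 1 h1I
  have hwx := hw x hxI
  set B := β * (1 - β) with hB
  have hB0 : 0 < B := mul_pos hβ0 (by linarith)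
  set C := B / w 1 with hC
  have hC0 : 0 < C := by positivity
  have hC1 : C * w 1 = B := by rw [hC]; field_simp
  have hq : ∀ t ∈ Icc (0:ℝ) 1, 1 - 4*β*(1-β) * k 1 / k t = 1 - 4 * (C * w t) := fun t ht => by
    have := hkpos t ht
    have := hkpos 1 h1I
    rw [hC, hB, hwdef]; field_simp
  have hCle : ∀ t ∈ Icc (0:ℝ) 1, C * w t ≤ B := fun t ht => by
    rw [← hC1]; exact mul_le_mul_of_nonneg_left (hwm ht h1I ht.2) hC0.le
  have hβsq : ∀ t ∈ Icc (0:ℝ) 1, 1 - 2 * β ≤ √(1 - 4 * (C * w t)) := fun t ht => by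
    apply Real.le_sqrt_of_sq_le
    have := hCle t ht
    rw [hB] at this
    nlinarith
  have hsq : ∀ t ∈ Icc (0:ℝ) 1, √(1 - 4 * (C * w t)) ^ 2 = 1 - 4 * (C * w t) := fun t ht => by
    apply Real.sq_sqrt
    have := hCle t ht
    rw [hB] at this
    nlinarith [sq_nonneg (1 - 2 * β)]
  rw [rhoStarLow, hq 0 h0I] at hα0 hαne
  rw [hq x hxI]
  set s₀ := √(1 - 4 * (C * w 0)) with hs₀
  set s := √(1 - 4 * (C * w x)) with hs
  have hs₀sq := hsq 0 h0I
  have hssq := hsq x hxI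
  have hs₀β := hβsq 0 h0I
  have hsβ := hβsq x hxI
  rw [← hs₀] at hs₀sq hs₀β
  rw [← hs] at hssq hsβ
  have hss₀ : s ≤ s₀ := Real.sqrt_le_sqrt (by nlinarith)
  have hα : 0 < α := by
    have : s₀ < 1 := by nlinarith [mul_pos hC0 hw0]
    linarith
  have hcases : C * w 0 < α * (1 - α) ∨ 1 / 2 * (1 + s₀) < α := by
    rcases lt_or_gt_of_ne hαne with h | h
    · left
      nlinarith [mul_pos (by linarith : 0 < 1 / 2 * (1 + s₀) - α)
        (by linarith : 0 < α - (1 - 1 / 2 * (1 + s₀)))]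
    · exact Or.inr h
  -- a solution below the attracting branch at `z` would need the wrong entrance flux
  have hexcl : ∀ z ∈ Ioc (0:ℝ) 1, ∀ P κ, 1 / 2 ≤ P → P < 1 / 2 * (1 + s₀) → 0 < κ →
      ∃ ν > 0, ∃ ε₀ > 0, ∀ ε, 0 < ε → ε < ε₀ → ρ ε z ≤ P → J ε * w z + κ ≤ P * (1 - P) →
        J ε < C + ν → False := by
    intro z hz P κ hP hP1 hκ
    have hs₀1 : s₀ < 1 := by nlinarith [mul_pos hC0 hw0]
    rcases hcases with h | h
    · obtain ⟨η, hη, hηe⟩ : ∃ η > 0, C * w 0 + 2 * η = α * (1 - α) :=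
        ⟨(α * (1 - α) - C * w 0) / 2, by linarith, by ring⟩
      obtain ⟨ε₀, hε₀, H⟩ := IsReducedSolution.eventually_entrance_near hα hβ0 hα1 hw hwc hwm hz hP
        (by linarith) hκ hη
      refine ⟨η / w 0, by positivity, ε₀, hε₀, fun ε hε hεs h1 h2 h3 => ?_⟩
      have h4 := (H ε _ _ _ hε hεs (hred ε hε) h1 h2).2.2
      have h5 := (hred ε hε).inflow
      have h6 : J ε * w 0 < C * w 0 + η := by
        have := mul_lt_mul_of_pos_right h3 hw0
        rwa [add_mul, div_mul_cancel₀ _ hw0.ne'] at this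
      nlinarith
    · obtain ⟨ε₀, hε₀, H⟩ := IsReducedSolution.eventually_entrance_near hα hβ0 hα1 hw hwc hwm hz hP
        (by linarith) hκ (η := α - P) (by linarith)
      refine ⟨1, one_pos, ε₀, hε₀, fun ε hε hεs h1 h2 h3 => ?_⟩
      have h4 := H ε _ _ _ hε hεs (hred ε hε) h1 h2
      linarith [h4.1, h4.2.1]
  have hev : ∀ ε₀ > (0:ℝ), ∀ᶠ ε in nhdsWithin 0 (Ioi 0), 0 < ε ∧ ε < ε₀ := fun ε₀ hε₀ =>
    Ioo_mem_nhdsGT hε₀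
  have h11 : (1:ℝ) ∈ Ioc (0:ℝ) 1 := by simp
  have hJlim : Tendsto J (nhdsWithin 0 (Ioi 0)) (nhds C) := by
    refine tendsto_order.2 ⟨fun c hc => ?_, fun c hc => ?_⟩
    · obtain ⟨δ, hδ, hδe⟩ : ∃ δ > 0, c * w 1 = B - β * δ :=
        ⟨(C - c) * w 1 / β, by have := sub_pos.2 hc; positivity, by rw [← hC1]; field_simp; ring⟩
      set P := max (1 / 2) (1 - β - δ) with hP
      have hP2 : 1 / 2 ≤ P := le_max_left _ _
      have hP3 : 1 - β - δ ≤ P := le_max_right _ _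
      have hP1 : P < 1 - β := max_lt (by linarith) (by linarith)
      obtain ⟨ν, hν, ε₀, hε₀, H⟩ := hexcl 1 h11 P (P * (1 - β - P)) hP2 (by linarith)
        (mul_pos (by linarith) (by linarith))
      filter_upwards [hev ε₀ hε₀] with ε hε
      by_contra! hcon
      have hout := (hred ε hε.1).outflow
      have h1 : J ε * w 1 ≤ c * w 1 := mul_le_mul_of_nonneg_right hcon hw1.le
      have h2 : ρ ε 1 ≤ P := by
        refine le_trans ?_ hP3
        refine le_of_mul_le_mul_left (a := β) ?_ hβ0
        rw [← hout]; linarith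
      refine H ε hε.1 hε.2 h2 ?_ (by linarith)
      rw [hout]
      nlinarith [mul_le_mul_of_nonneg_left h2 hβ0.le]
    · obtain ⟨δ, hδ, hδe⟩ : ∃ δ > 0, c * w 1 = B + β * δ :=
        ⟨(c - C) * w 1 / β, by have := sub_pos.2 hc; positivity, by rw [← hC1]; field_simp; ring⟩
      obtain ⟨ε₀, hε₀, H⟩ := IsReducedSolution.eventually_flux_le hα hβ0 hα1 hw hwc h11
        (p := 1 - β + δ) (κ := δ / 4) (by linarith) (by linarith)
      filter_upwards [hev ε₀ hε₀] with ε hε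
      by_contra! hcon
      have hout := (hred ε hε.1).outflow
      have h1 : c * w 1 ≤ J ε * w 1 := mul_le_mul_of_nonneg_right hcon hw1.le
      have h2 : 1 - β + δ ≤ ρ ε 1 := by
        refine le_of_mul_le_mul_left (a := β) ?_ hβ0
        rw [← hout]; linarith
      have h3 := H ε _ _ _ hε.1 hε.2 (hred ε hε.1) h2
      rw [hout] at h3
      nlinarith [mul_le_mul_of_nonneg_left h2 hβ0.le]
  have hJx : Tendsto (fun ε => J ε * w x) (nhdsWithin 0 (Ioi 0)) (nhds (C * w x)) :=
    hJlim.mul_const _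
  refine tendsto_order.2 ⟨fun c hc => ?_, fun c hc => ?_⟩
  · obtain ⟨η, hη, hηs, hηc⟩ : ∃ η > 0, 2 * η ≤ s ∧ c ≤ 1 / 2 * (1 + s) - η :=
      ⟨min (s / 2) (1 / 2 * (1 + s) - c), lt_min (by linarith) (by linarith),
        by linarith [min_le_left (s / 2) (1 / 2 * (1 + s) - c)],
        by linarith [min_le_right (s / 2) (1 / 2 * (1 + s) - c)]⟩
    obtain ⟨ν, hν, ε₀, hε₀, H⟩ := hexcl x hx (1 / 2 * (1 + s) - η) (η ^ 2 / 2) (by linarith)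
      (by linarith) (by positivity)
    filter_upwards [hev ε₀ hε₀, hJlim.eventually_lt_const (by linarith : C < C + ν),
      hJx.eventually_lt_const (by nlinarith : C * w x < C * w x + η ^ 2 / 2)] with ε hε hJ1 hJ2
    by_contra! hcon
    exact H ε hε.1 hε.2 (hcon.trans hηc) (by nlinarith) hJ1
  · obtain ⟨η, hη, rfl⟩ : ∃ η > 0, c = 1 / 2 * (1 + s) + η :=
      ⟨c - 1 / 2 * (1 + s), by linarith, by ring⟩
    obtain ⟨ε₀, hε₀, H⟩ := IsReducedSolution.eventually_flux_le hα hβ0 hα1 hw hwc hx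
      (p := 1 / 2 * (1 + s) + η) (κ := η ^ 2 / 2) (by linarith) (by positivity)
    filter_upwards [hev ε₀ hε₀,
      hJx.eventually_const_lt (by nlinarith : C * w x - η ^ 2 / 2 < C * w x)] with ε hε hJ1
    by_contra! hcon
    have h3 := H ε _ _ _ hε.1 hε.2 (hred ε hε.1) hcon
    nlinarith [mul_pos hη (by linarith : 0 < s)]
end

section
/- Assume ρ_f < α < 1 with α ≠ 1 − ρ_f, and 1/2 < β < 1. Define A(x) = (1/2)·(1 + √(1 − k(1)/k(x))) for x ∈ [0,1], ρ₀ = 1 − k(1)/(4α·k(0)), ρ₁ = 1/(4β), and the singular orbit Γ ⊆ ℝ² as the union of the vertical segment {0} × [min(ρ₀, A(0)), max(ρ₀, A(0))], the curve {(x, A(x)) : x ∈ [0,1]}, and the vertical segment {1} × [ρ₁, 1/2]. Suppose that for every ε > 0, (ρ_ε, J_ε) is a classical solution of the area-averaged pedestrian boundary value problem on [0,1] with diffusion ε. Then there exist constants C > 0 and ε₀ > 0 such that for all ε ∈ (0, ε₀), the Hausdorff distance between the graph {(x, ρ_ε(x)) : x ∈ [0,1]} and Γ is at most C·ε^{2/3}.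 -/
open Set Filter

/-- Slow branch of the singular orbit in region G₃ ∪ G₄:
`A(x) = (1/2)·(1 + √(1 − k(1)/k(x)))`. -/
noncomputable def slowBranch34 (k : ℝ → ℝ) (x : ℝ) : ℝ :=
  (1/2) * (1 + Real.sqrt (1 - k 1 / k x))

/-- `u` solves the Riccati equation `t³ u' = h - u²` on `[0, 1]`. -/
def IsRiccatiFlow (t : ℝ) (h u : ℝ → ℝ) : Prop :=
  ∀ x ∈ Icc (0:ℝ) 1, HasDerivWithinAt u ((h x - u x ^ 2) / t ^ 3) (Icc 0 1) x

/-- A function with `w' ≤ -(t² + w²) / t³` cannot exist on an interval of length `4t² > πt²`. -/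
lemma riccati_blowup {t p q : ℝ} {w w' : ℝ → ℝ} (ht : 0 < t) (hpq : p + 4 * t ^ 2 ≤ q)
    (hw : ∀ x ∈ Icc p q, HasDerivWithinAt w (w' x) (Icc p q) x)
    (hle : ∀ x ∈ Icc p q, w' x ≤ -(t ^ 2 + w x ^ 2) / t ^ 3) : False := by
  have hpq' : p ≤ q := by nlinarith [sq_nonneg t]
  have hd : ∀ x ∈ Icc p q, HasDerivWithinAt (fun y => Real.arctan (w y / t) + y / t ^ 2)
      (1 / (1 + (w x / t) ^ 2) * (w' x / t) + 1 / t ^ 2) (Icc p q) x := fun x hx =>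
    (((hw x hx).div_const t).arctan).add ((hasDerivWithinAt_id x _).div_const _)
  have hanti : AntitoneOn (fun y => Real.arctan (w y / t) + y / t ^ 2) (Icc p q) := by
    refine antitoneOn_of_hasDerivWithinAt_nonpos (convex_Icc p q)
      (fun x hx => (hd x hx).continuousWithinAt)
      (fun x hx => (hd x (interior_subset hx)).mono interior_subset) (fun x hx => ?_)
    have h1 := hle x (interior_subset hx)
    have h2 : 1 / (1 + (w x / t) ^ 2) * (w' x / t) ≤
        1 / (1 + (w x / t) ^ 2) * ((-(t ^ 2 + w x ^ 2) / t ^ 3) / t) := by gcongr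
    have h3 : 1 / (1 + (w x / t) ^ 2) * ((-(t ^ 2 + w x ^ 2) / t ^ 3) / t) = -(1 / t ^ 2) := by
      have : t ^ 2 + w x ^ 2 ≠ 0 := by positivity
      field_simp
    linarith
  have h := hanti (left_mem_Icc.2 hpq') (right_mem_Icc.2 hpq') hpq'
  simp only at h
  have h1 := Real.arctan_lt_pi_div_two (w p / t)
  have h2 := Real.neg_pi_div_two_lt_arctan (w q / t)
  have h3 : 4 ≤ (q - p) / t ^ 2 := by
    rw [le_div_iff₀ (by positivity)]; linarith
  have h4 : (q - p) / t ^ 2 = q / t ^ 2 - p / t ^ 2 := by ring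
  linarith [Real.pi_lt_four]

namespace IsRiccatiFlow

variable {t p q G : ℝ} {h u : ℝ → ℝ}

lemma continuousOn (hu : IsRiccatiFlow t h u) : ContinuousOn u (Icc 0 1) :=
  fun x hx => (hu x hx).continuousWithinAt

lemma hasDerivWithinAt_Ici (hu : IsRiccatiFlow t h u) (hp : 0 ≤ p) (hq : q ≤ 1) :
    ∀ x ∈ Ico p q, HasDerivWithinAt u ((h x - u x ^ 2) / t ^ 3) (Ici x) x := fun x hx =>
  (hu x ⟨hp.trans hx.1, hx.2.le.trans hq⟩).mono_of_mem_nhdsWithin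
    (mem_of_superset (Icc_mem_nhdsGE hx.2) (Icc_subset_Icc (hp.trans hx.1) hq))

lemma le_of_barrier (hu : IsRiccatiFlow t h u) (ht : 0 < t) (hp : 0 ≤ p) (hq : q ≤ 1)
    (hG : u p ≤ G) (hh : ∀ x ∈ Icc p q, h x < G ^ 2) : ∀ x ∈ Icc p q, u x ≤ G := by
  intro x hx
  refine image_le_of_deriv_right_lt_deriv_boundary' (B := fun _ => G) (B' := fun _ => 0)
    (hu.continuousOn.mono (Icc_subset_Icc hp hq)) (hu.hasDerivWithinAt_Ici hp hq) hG
    continuousOn_const (fun _ _ => hasDerivWithinAt_const _ _ _) (fun y hy hy' => ?_) hx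
  have := hh y ⟨hy.1, hy.2.le⟩
  exact div_neg_of_neg_of_pos (by rw [hy']; linarith) (by positivity)

lemma ge_of_barrier (hu : IsRiccatiFlow t h u) (ht : 0 < t) (hp : 0 ≤ p) (hq : q ≤ 1)
    (hG : G ≤ u p) (hh : ∀ x ∈ Icc p q, G ^ 2 < h x) : ∀ x ∈ Icc p q, G ≤ u x := by
  intro x hx
  refine image_le_of_deriv_right_lt_deriv_boundary' (f := fun _ => G) (f' := fun _ => 0)
    continuousOn_const (fun _ _ => hasDerivWithinAt_const _ _ _) hG
    (hu.continuousOn.mono (Icc_subset_Icc hp hq)) (hu.hasDerivWithinAt_Ici hp hq)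
    (fun y hy hy' => ?_) hx
  have := hh y ⟨hy.1, hy.2.le⟩
  exact div_pos (by rw [← hy']; linarith) (by positivity)

lemma le_of_forall_le (hu : IsRiccatiFlow t h u) (ht : 0 < t) (hp : 0 ≤ p) (hq : q ≤ 1)
    (hpq : p + 4 * t ^ 2 ≤ q) (hG : 0 ≤ G) (hh : ∀ x ∈ Icc p q, h x ≤ G ^ 2 - t ^ 2) :
    u q ≤ G := by
  have ht2 : 0 < t ^ 2 := by positivity
  by_cases hex : ∃ y ∈ Icc p q, u y ≤ G
  · obtain ⟨y, hy, hyG⟩ := hex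
    exact hu.le_of_barrier ht (hp.trans hy.1) hq hyG
      (fun x hx => by linarith [hh x ⟨hy.1.trans hx.1, hx.2⟩]) q ⟨hy.2, le_rfl⟩
  · push Not at hex
    refine (riccati_blowup ht hpq (w := fun x => u x - G)
      (w' := fun x => (h x - u x ^ 2) / t ^ 3) (fun x hx => ?_) (fun x hx => ?_)).elim
    · exact ((hu x ⟨hp.trans hx.1, hx.2.trans hq⟩).mono (Icc_subset_Icc hp hq)).sub_const _
    · have h1 := hh x hx
      have h2 := hex x hx
      have : h x - u x ^ 2 ≤ -(t ^ 2 + (u x - G) ^ 2) := by nlinarith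
      gcongr

lemma ge_of_forall_ge (hu : IsRiccatiFlow t h u) (ht : 0 < t) (hp : 0 ≤ p) (hq : q ≤ 1)
    (hpq : p + 4 * t ^ 2 ≤ q) (hu0 : ∀ x ∈ Icc p q, 0 ≤ u x)
    (hh : ∀ x ∈ Icc p q, G ^ 2 + t ^ 2 ≤ h x) : G ≤ u q := by
  have ht2 : 0 < t ^ 2 := by positivity
  by_cases hex : ∃ y ∈ Icc p q, G ≤ u y
  · obtain ⟨y, hy, hyG⟩ := hex
    exact hu.ge_of_barrier ht (hp.trans hy.1) hq hyG
      (fun x hx => by linarith [hh x ⟨hy.1.trans hx.1, hx.2⟩]) q ⟨hy.2, le_rfl⟩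
  · push Not at hex
    refine (riccati_blowup ht hpq (w := fun x => G - u x)
      (w' := fun x => -((h x - u x ^ 2) / t ^ 3)) (fun x hx => ?_) (fun x hx => ?_)).elim
    · exact ((hu x ⟨hp.trans hx.1, hx.2.trans hq⟩).mono (Icc_subset_Icc hp hq)).const_sub _
    · have h1 := hh x hx
      have h2 := hex x hx
      have h3 := hu0 x hx
      have : t ^ 2 + (G - u x) ^ 2 ≤ h x - u x ^ 2 := by nlinarith
      rw [neg_div]
      gcongr

/-- Entrance layer: starting above an unstable level `c ≤ 0`, the flow reaches `0`. -/
lemma exists_nonneg (hu : IsRiccatiFlow t h u) (ht : 0 < t) (hq0 : 0 < q) (hq : q ≤ 1)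
    {c d : ℝ} (hc : c ≤ u 0) (hd : 0 < d) (hh : ∀ x ∈ Icc 0 q, c ^ 2 + d ≤ h x)
    (hsmall : -c * t ^ 3 ≤ d * q) : ∃ y ∈ Icc 0 q, 0 ≤ u y := by
  by_contra! hneg
  have hcu := hu.ge_of_barrier ht le_rfl hq hc (fun x hx => by linarith [hh x hx])
  have hmono : MonotoneOn (fun x => u x - d / t ^ 3 * x) (Icc 0 q) := by
    have hder : ∀ x ∈ Icc 0 q, HasDerivWithinAt (fun x => u x - d / t ^ 3 * x)
        ((h x - u x ^ 2) / t ^ 3 - d / t ^ 3 * 1) (Icc 0 q) x := fun x hx =>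
      ((hu x ⟨hx.1, hx.2.trans hq⟩).mono (Icc_subset_Icc le_rfl hq)).sub
        ((hasDerivWithinAt_id x _).const_mul _)
    refine monotoneOn_of_hasDerivWithinAt_nonneg (convex_Icc 0 q)
      (fun x hx => (hder x hx).continuousWithinAt)
      (fun x hx => (hder x (interior_subset hx)).mono interior_subset) (fun x hx => ?_)
    have hx' := interior_subset hx
    have h1 := hh x hx'
    have h2 := hneg x hx'
    have h3 := hcu x hx'
    have h4 : d ≤ h x - u x ^ 2 := by nlinarith
    have : d / t ^ 3 ≤ (h x - u x ^ 2) / t ^ 3 := by gcongr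
    linarith
  have h1 := hmono (left_mem_Icc.2 hq0.le) (right_mem_Icc.2 hq0.le) hq0.le
  have h2 := hneg q (right_mem_Icc.2 hq0.le)
  have h3 : -c ≤ d / t ^ 3 * q := by
    rw [div_mul_eq_mul_div, le_div_iff₀ (by positivity)]; exact hsmall
  simp only [mul_zero, sub_zero] at h1
  linarith

end IsRiccatiFlow

/-- A positive profile `f` (the reciprocal of the width) with two-sided Lipschitz bounds,
normalised by the critical flux `J₀`. -/
structure IsFluxProfile (f : ℝ → ℝ) (m M J₀ : ℝ) : Prop where
  m_pos : 0 < m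
  M_pos : 0 < M
  J_pos : 0 < J₀
  f_pos : 0 < f 0
  crit : J₀ * f 1 = 1 / 4
  lower : ∀ x y, 0 ≤ x → x ≤ y → y ≤ 1 → m * (y - x) ≤ J₀ * f y - J₀ * f x
  upper : ∀ x y, 0 ≤ x → x ≤ y → y ≤ 1 → J₀ * f y - J₀ * f x ≤ M * (y - x)

namespace IsFluxProfile

variable {f : ℝ → ℝ} {m M J₀ : ℝ}

lemma mono (F : IsFluxProfile f m M J₀) {x y : ℝ} (hx : 0 ≤ x) (hxy : x ≤ y) (hy : y ≤ 1) :
    f x ≤ f y := by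
  have h := F.lower x y hx hxy hy
  have := mul_nonneg F.m_pos.le (sub_nonneg.2 hxy)
  exact le_of_mul_le_mul_left (by linarith) F.J_pos

/-- The slow branch, measured from `1/2`. -/
noncomputable def branch (f : ℝ → ℝ) (J₀ x : ℝ) : ℝ := √(1 / 4 - J₀ * f x)

lemma branch_sq (F : IsFluxProfile f m M J₀) {x : ℝ} (hx : 0 ≤ x) (hx1 : x ≤ 1) :
    branch f J₀ x ^ 2 = 1 / 4 - J₀ * f x := by
  refine Real.sq_sqrt ?_
  have := F.lower x 1 hx hx1 le_rfl
  have := mul_nonneg F.m_pos.le (sub_nonneg.2 hx1)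
  linarith [F.crit]

lemma branch_anti (F : IsFluxProfile f m M J₀) {x y : ℝ} (hx : 0 ≤ x) (hxy : x ≤ y)
    (hy : y ≤ 1) : branch f J₀ y ≤ branch f J₀ x := by
  refine Real.sqrt_le_sqrt ?_
  have := mul_le_mul_of_nonneg_left (F.mono hx hxy hy) F.J_pos.le
  linarith

lemma branch_one (F : IsFluxProfile f m M J₀) : branch f J₀ 1 = 0 := by
  simp [branch, F.crit]

lemma branch_zero_pos (F : IsFluxProfile f m M J₀) : 0 < branch f J₀ 0 := by
  refine Real.sqrt_pos.2 ?_
  have := F.lower 0 1 le_rfl zero_le_one le_rfl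
  linarith [F.crit, F.m_pos]

lemma le_flux_of_flow (F : IsFluxProfile f m M J₀) {C t J : ℝ} {u : ℝ → ℝ} (ht : 0 < t)
    (ht4 : 4 * t ^ 2 ≤ 1) (hC : 4 * M + 1 ≤ C * f 0)
    (hu : IsRiccatiFlow t (fun x => 1 / 4 - J * f x) u) : J ≤ J₀ + C * t ^ 2 := by
  by_contra! hJ
  have hsub : Icc (1 - 4 * t ^ 2) 1 ⊆ Icc (0:ℝ) 1 := Icc_subset_Icc (by linarith) le_rfl
  refine riccati_blowup ht (p := 1 - 4 * t ^ 2) (q := 1) (w := u) (by linarith)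
    (fun x hx => (hu x (hsub hx)).mono hsub) (fun x hx => ?_)
  have hx' := hsub hx
  have h1 := F.upper x 1 hx'.1 hx'.2 le_rfl
  have h2 := F.mono le_rfl hx'.1 hx'.2
  have h3 : C * t ^ 2 * f 0 ≤ (J - J₀) * f x :=
    mul_le_mul (by linarith) h2 F.f_pos.le
      (by have : 0 ≤ C := (pos_of_mul_pos_left (by linarith [F.M_pos]) F.f_pos.le).le
          nlinarith [sq_nonneg t])
  have h4 : M * (1 - x) ≤ M * (4 * t ^ 2) :=
    mul_le_mul_of_nonneg_left (by linarith [hx.1]) F.M_pos.le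
  have h5 : (4 * M + 1) * t ^ 2 ≤ C * f 0 * t ^ 2 := by gcongr
  have : 1 / 4 - J * f x - u x ^ 2 ≤ -(t ^ 2 + u x ^ 2) := by
    linarith [F.crit]
  gcongr

lemma flux_ge_of_flow (F : IsFluxProfile f m M J₀) {t J y : ℝ} {u : ℝ → ℝ} (ht : 0 < t)
    (hu : IsRiccatiFlow t (fun x => 1 / 4 - J * f x) u) (hy : y ∈ Icc (0:ℝ) 1) (huy : 0 ≤ u y)
    (hu1 : J < J₀ → u 1 < 0) : J₀ ≤ J := by
  by_contra! hJ
  have := hu.ge_of_barrier ht hy.1 le_rfl huy (fun x hx => ?_) 1 ⟨hy.2, le_rfl⟩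
  · linarith [hu1 hJ]
  · have h0 := hy.1.trans hx.1
    have hf := F.f_pos.trans_le (F.mono le_rfl h0 hx.2)
    have h1 := mul_le_mul_of_nonneg_left (F.mono h0 hx.2 le_rfl) F.J_pos.le
    have h2 := mul_lt_mul_of_pos_right hJ hf
    simp only [ne_eq, OfNat.ofNat_ne_zero, not_false_eq_true, zero_pow]
    linarith [F.crit]

end IsFluxProfile

/-- A flow with nearly critical flux `J`, whose end values are close to `u₀` and `u₁ < 0`, together
with constants `K`, `C`, `B`, `b` controlling the widths of the layers. -/
structure IsLayerFlow (f u : ℝ → ℝ) (m M J₀ J C K B u₀ u₁ b t : ℝ) : Prop where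
  profile : IsFluxProfile f m M J₀
  t_pos : 0 < t
  flow : IsRiccatiFlow t (fun x => 1 / 4 - J * f x) u
  J_ge : J₀ ≤ J
  J_le : J ≤ J₀ + C * t ^ 2
  C_pos : 0 < C
  K_ge : 8 ≤ K
  mK_ge : C * f 1 + 2 ≤ m * K
  t_small : 4 * (K * t ^ 2) ≤ 1
  start : ∃ y ∈ Icc 0 (K * t ^ 2), 0 ≤ u y
  u_zero_le : u 0 ≤ u₀
  le_u_zero : u₀ - B * t ^ 2 ≤ u 0
  le_u_one : u₁ ≤ u 1
  u_one_le : u 1 ≤ u₁ + B * t ^ 2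
  b_pos : 0 < b
  u_one_neg : u 1 ≤ -b
  b_large : M * (K * t ^ 2) < b ^ 2

namespace IsLayerFlow

open IsFluxProfile

variable {f u : ℝ → ℝ} {m M J₀ J C K B u₀ u₁ b t x : ℝ}

lemma sq_pos (D : IsLayerFlow f u m M J₀ J C K B u₀ u₁ b t) : 0 < t ^ 2 := by
  have := D.t_pos
  positivity

lemma eight_le (D : IsLayerFlow f u m M J₀ J C K B u₀ u₁ b t) : 8 * t ^ 2 ≤ K * t ^ 2 :=
  mul_le_mul_of_nonneg_right D.K_ge D.sq_pos.le

lemma le_force (D : IsLayerFlow f u m M J₀ J C K B u₀ u₁ b t) (hx : 0 ≤ x) (hx1 : x ≤ 1) :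
    1 / 4 - J₀ * f x - C * f 1 * t ^ 2 ≤ 1 / 4 - J * f x := by
  have h1 := D.profile.mono hx hx1 le_rfl
  have h0 := D.profile.f_pos.trans_le (D.profile.mono le_rfl hx hx1)
  have h2 : (J - J₀) * f x ≤ (C * t ^ 2) * f 1 :=
    mul_le_mul (by linarith [D.J_le]) h1 h0.le (mul_nonneg D.C_pos.le D.sq_pos.le)
  linarith

lemma force_le (D : IsLayerFlow f u m M J₀ J C K B u₀ u₁ b t) (hx : 0 ≤ x) (hx1 : x ≤ 1) :
    1 / 4 - J * f x ≤ 1 / 4 - J₀ * f x := by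
  have h0 := D.profile.f_pos.trans_le (D.profile.mono le_rfl hx hx1)
  have := mul_le_mul_of_nonneg_right D.J_ge h0.le
  linarith

lemma margin (D : IsLayerFlow f u m M J₀ J C K B u₀ u₁ b t) :
    C * f 1 * t ^ 2 + 2 * t ^ 2 ≤ m * (K * t ^ 2) := by
  have := mul_le_mul_of_nonneg_right D.mK_ge D.sq_pos.le
  linarith

lemma u_nonneg (D : IsLayerFlow f u m M J₀ J C K B u₀ u₁ b t) (hx : K * t ^ 2 ≤ x)
    (hx1 : x ≤ 1 - K * t ^ 2) : 0 ≤ u x := by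
  obtain ⟨y, hy, huy⟩ := D.start
  have hτ := D.eight_le
  have ht := D.sq_pos
  refine D.flow.ge_of_barrier D.t_pos hy.1 (q := 1 - K * t ^ 2) (by linarith) huy
    (fun z hz => ?_) x ⟨hy.2.trans hx, hx1⟩
  have hz0 := hy.1.trans hz.1
  have h1 := D.le_force hz0 (by linarith [hz.2])
  have h2 := D.profile.lower z 1 hz0 (by linarith [hz.2]) le_rfl
  have h3 := mul_le_mul_of_nonneg_left (show K * t ^ 2 ≤ 1 - z by linarith [hz.2])
    D.profile.m_pos.le
  simp only [ne_eq, OfNat.ofNat_ne_zero, not_false_eq_true, zero_pow]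
  linarith [D.margin, D.profile.crit]

lemma u_le (D : IsLayerFlow f u m M J₀ J C K B u₀ u₁ b t) (hx : K * t ^ 2 ≤ x) (hx1 : x ≤ 1) :
    u x ≤ branch f J₀ (x - K * t ^ 2) := by
  have hτ := D.eight_le
  have ht := D.sq_pos
  refine D.flow.le_of_forall_le D.t_pos (p := x - K * t ^ 2 / 2) (by linarith) hx1 (by linarith)
    (Real.sqrt_nonneg _) (fun z hz => ?_)
  have hz0 : 0 ≤ z := by linarith [hz.1]
  have hz1 := hz.2.trans hx1
  rw [D.profile.branch_sq (by linarith) (by linarith)]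
  have h1 := D.force_le hz0 hz1
  have h2 := D.profile.lower (x - K * t ^ 2) z (by linarith) (by linarith [hz.1]) hz1
  have h3 := mul_le_mul_of_nonneg_left
    (show K * t ^ 2 / 2 ≤ z - (x - K * t ^ 2) by linarith [hz.1]) D.profile.m_pos.le
  have h4 : 0 < C * f 1 * t ^ 2 := by
    have := D.C_pos
    have := D.profile.f_pos.trans_le (D.profile.mono le_rfl zero_le_one le_rfl)
    positivity
  linarith [D.margin]

lemma le_u (D : IsLayerFlow f u m M J₀ J C K B u₀ u₁ b t) (hx : 2 * (K * t ^ 2) ≤ x)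
    (hx1 : x ≤ 1 - K * t ^ 2) : branch f J₀ (x + K * t ^ 2) ≤ u x := by
  have hτ := D.eight_le
  have ht := D.sq_pos
  refine D.flow.ge_of_forall_ge D.t_pos (p := x - K * t ^ 2) (by linarith) (by linarith)
    (by linarith) (fun z hz => D.u_nonneg (by linarith [hz.1]) (by linarith [hz.2]))
    (fun z hz => ?_)
  have hz0 : 0 ≤ z := by linarith [hz.1]
  have hz1 : z ≤ 1 := by linarith [hz.2]
  rw [D.profile.branch_sq (by linarith) (by linarith)]
  have h1 := D.le_force hz0 hz1
  have h2 := D.profile.lower z (x + K * t ^ 2) hz0 (by linarith [hz.2]) (by linarith)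
  have h3 := mul_le_mul_of_nonneg_left
    (show K * t ^ 2 ≤ x + K * t ^ 2 - z by linarith [hz.2]) D.profile.m_pos.le
  linarith [D.margin]

lemma u_one_le_u (D : IsLayerFlow f u m M J₀ J C K B u₀ u₁ b t) (hx : 1 - K * t ^ 2 ≤ x)
    (hx1 : x ≤ 1) : u 1 ≤ u x := by
  by_contra! hlt
  have hτ := D.eight_le
  have ht := D.sq_pos
  have hx0 : 0 ≤ x := by linarith [D.t_small]
  refine hlt.not_ge (D.flow.le_of_barrier D.t_pos hx0 le_rfl le_rfl (fun z hz => ?_) 1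
    ⟨hx1, le_rfl⟩)
  have hz0 := hx0.trans hz.1
  have h1 := D.force_le hz0 hz.2
  have h2 := D.profile.upper z 1 hz0 hz.2 le_rfl
  have h3 := mul_le_mul_of_nonneg_left (show 1 - z ≤ K * t ^ 2 by linarith [hz.1])
    D.profile.M_pos.le
  have h4 : b ^ 2 ≤ u x ^ 2 := by nlinarith [D.u_one_neg, D.b_pos]
  linarith [D.b_large, D.profile.crit]

lemma u_le_max (D : IsLayerFlow f u m M J₀ J C K B u₀ u₁ b t) (hx : 0 ≤ x) (hx1 : x ≤ 1) :
    u x ≤ max u₀ (branch f J₀ 0) + t ^ 2 := by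
  have ht := D.sq_pos
  refine D.flow.le_of_barrier D.t_pos le_rfl le_rfl
    (by linarith [D.u_zero_le, le_max_left u₀ (branch f J₀ 0)]) (fun z hz => ?_) x ⟨hx, hx1⟩
  have h1 := D.force_le hz.1 hz.2
  have h2 := mul_le_mul_of_nonneg_left (D.profile.mono le_rfl hz.1 hz.2) D.profile.J_pos.le
  have h3 := D.profile.branch_sq le_rfl zero_le_one
  have h4 := le_max_right u₀ (branch f J₀ 0)
  have h5 := D.profile.branch_zero_pos
  nlinarith

lemma min_le_u (D : IsLayerFlow f u m M J₀ J C K B u₀ u₁ b t) {E : ℝ} (hE : B ≤ E)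
    (hE' : 2 * M * K + C * f 1 + 1 ≤ E * branch f J₀ 0) (hEt : E * t ^ 2 ≤ branch f J₀ 0)
    (hEt' : 2 * (E * t ^ 2) ≤ u₀ + branch f J₀ 0) (hx : 0 ≤ x) (hx1 : x ≤ 2 * (K * t ^ 2)) :
    min u₀ (branch f J₀ 0) - E * t ^ 2 ≤ u x := by
  have ht := D.sq_pos
  have hts := D.t_small
  have hτ := D.eight_le
  set g := branch f J₀ 0 with hg
  have hBE := mul_le_mul_of_nonneg_right hE ht.le
  refine D.flow.ge_of_barrier D.t_pos le_rfl (q := 2 * (K * t ^ 2)) (by linarith)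
    (by linarith [D.le_u_zero, min_le_left u₀ g]) (fun z hz => ?_) x ⟨hx, hx1⟩
  have hz1 : z ≤ 1 := by linarith [hz.2]
  have h1 := D.le_force hz.1 hz1
  have h2 := D.profile.upper 0 z le_rfl hz.1 hz1
  have h3 := D.profile.branch_sq le_rfl zero_le_one
  rw [← hg] at h3
  have h4 := mul_le_mul_of_nonneg_left (show z - 0 ≤ 2 * (K * t ^ 2) by linarith [hz.2])
    D.profile.M_pos.le
  have h5 : (min u₀ g - E * t ^ 2) ^ 2 ≤ (g - E * t ^ 2) ^ 2 := by
    refine sq_le_sq' ?_ (by linarith [min_le_right u₀ g])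
    have : 2 * (E * t ^ 2) - g ≤ min u₀ g := le_min (by linarith) (by linarith)
    linarith
  have hE0 : 0 ≤ E * t ^ 2 := by
    have : 0 < E * g := by
      have := D.profile.M_pos
      have := D.K_ge
      have := D.C_pos
      have := D.profile.f_pos.trans_le (D.profile.mono le_rfl zero_le_one le_rfl)
      have : 0 < 2 * M * K + C * f 1 + 1 := by positivity
      linarith
    have := (pos_of_mul_pos_left this D.profile.branch_zero_pos.le)
    positivity
  have h6 : (g - E * t ^ 2) ^ 2 ≤ g ^ 2 - E * t ^ 2 * g := by nlinarith
  have h7 := mul_le_mul_of_nonneg_right hE' ht.le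
  linarith

end IsLayerFlow

/-- The singular orbit, with densities measured from `1/2`. -/
def singularOrbit (u₀ u₁ : ℝ) (g : ℝ → ℝ) : Set (ℝ × ℝ) :=
  (({0} : Set ℝ) ×ˢ Icc (min u₀ (g 0)) (max u₀ (g 0))) ∪ ((fun x => (x, g x)) '' Icc (0:ℝ) 1) ∪
    (({1} : Set ℝ) ×ˢ Icc u₁ 0)

namespace IsLayerFlow

open IsFluxProfile

variable {f u : ℝ → ℝ} {m M J₀ J C K B u₀ u₁ b t x E W : ℝ}

lemma exists_orbit_near (D : IsLayerFlow f u m M J₀ J C K B u₀ u₁ b t)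
    (hfc : ContinuousOn (branch f J₀) (Icc 0 1)) (hE : B ≤ E)
    (hE' : 2 * M * K + C * f 1 + 1 ≤ E * branch f J₀ 0) (hEt : E * t ^ 2 ≤ branch f J₀ 0)
    (hEt' : 2 * (E * t ^ 2) ≤ u₀ + branch f J₀ 0) (hWK : 2 * K ≤ W) (hWE : E ≤ W)
    (hx : 0 ≤ x) (hx1 : x ≤ 1) :
    ∃ P ∈ singularOrbit u₀ u₁ (branch f J₀), |x - P.1| ≤ W * t ^ 2 ∧ |u x - P.2| ≤ W * t ^ 2 := by
  have ht := D.sq_pos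
  have hts := D.t_small
  have hτ := D.eight_le
  have hWK' := mul_le_mul_of_nonneg_right hWK ht.le
  have hWE' := mul_le_mul_of_nonneg_right hWE ht.le
  rcases le_total x (2 * (K * t ^ 2)) with hx2 | hx2
  · have h1 := D.u_le_max hx hx1
    have h2 := D.min_le_u hE hE' hEt hEt' hx hx2
    have h3 : min u₀ (branch f J₀ 0) ≤ max u₀ (branch f J₀ 0) := min_le_max
    refine ⟨(0, max (min u₀ (branch f J₀ 0)) (min (u x) (max u₀ (branch f J₀ 0)))),
      Or.inl (Or.inl ⟨rfl, le_max_left _ _, max_le h3 (min_le_right _ _)⟩), ?_, ?_⟩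
    · rw [sub_zero, abs_of_nonneg hx]; linarith
    · rw [abs_le]
      constructor
      · have : max (min u₀ (branch f J₀ 0)) (min (u x) (max u₀ (branch f J₀ 0)))
            ≤ u x + W * t ^ 2 :=
          max_le (by linarith) ((min_le_left _ _).trans (by linarith))
        linarith
      · have : u x - W * t ^ 2 ≤ min (u x) (max u₀ (branch f J₀ 0)) :=
          le_min (by linarith) (by linarith)
        linarith [le_max_right (min u₀ (branch f J₀ 0)) (min (u x) (max u₀ (branch f J₀ 0)))]
  · have h1 := D.u_le (x := x) (by linarith) hx1
    have key : ∀ z, x ≤ z → z ≤ x + K * t ^ 2 → z ≤ 1 → branch f J₀ z ≤ u x →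
        ∃ P ∈ singularOrbit u₀ u₁ (branch f J₀),
          |x - P.1| ≤ W * t ^ 2 ∧ |u x - P.2| ≤ W * t ^ 2 := by
      intro z hxz hz hz1 hzu
      obtain ⟨y, hy, hyu⟩ := intermediate_value_Icc' (show x - K * t ^ 2 ≤ z by linarith)
        (hfc.mono (Icc_subset_Icc (by linarith) hz1)) ⟨hzu, h1⟩
      refine ⟨(y, branch f J₀ y), Or.inl (Or.inr ⟨y, ⟨by linarith [hy.1], hy.2.trans hz1⟩, rfl⟩),
        ?_, ?_⟩
      · rw [abs_le]
        constructor <;> linarith [hy.1, hy.2]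
      · simp only [hyu, sub_self, abs_zero]
        linarith
    rcases le_total x (1 - K * t ^ 2) with hx3 | hx3
    · exact key _ (by linarith) le_rfl (by linarith) (D.le_u hx2 hx3)
    · rcases le_total 0 (u x) with hu0 | hu0
      · exact key 1 hx1 (by linarith) le_rfl (by rwa [D.profile.branch_one])
      · refine ⟨(1, u x), Or.inr ⟨rfl, D.le_u_one.trans (D.u_one_le_u hx3 hx1), hu0⟩, ?_, ?_⟩
        · rw [abs_le]
          constructor <;> linarith
        · simp only [sub_self, abs_zero]
          linarith

lemma exists_graph_near (D : IsLayerFlow f u m M J₀ J C K B u₀ u₁ b t)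
    (hWK : 3 * K ≤ W) (hWB : B ≤ W) (hWM : 3 * M * K ≤ W * branch f J₀ 0) :
    ∀ P ∈ singularOrbit u₀ u₁ (branch f J₀), ∃ x ∈ Icc (0:ℝ) 1,
      |P.1 - x| ≤ W * t ^ 2 ∧ |P.2 - u x| ≤ W * t ^ 2 := by
  have ht := D.sq_pos
  have hts := D.t_small
  have hτ := D.eight_le
  have hWK' := mul_le_mul_of_nonneg_right hWK ht.le
  have hWB' := mul_le_mul_of_nonneg_right hWB ht.le
  have hcont : ∀ p q : ℝ, 0 ≤ p → q ≤ 1 → ContinuousOn u (Icc p q) := fun p q hp hq =>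
    D.flow.continuousOn.mono (Icc_subset_Icc hp hq)
  have hg := D.profile.branch_zero_pos
  have hdrop : branch f J₀ 0 - branch f J₀ (3 * (K * t ^ 2)) ≤ W * t ^ 2 := by
    have h1 := D.profile.branch_sq le_rfl zero_le_one
    have h2 := D.profile.branch_sq (x := 3 * (K * t ^ 2)) (by linarith) (by linarith)
    have h3 := D.profile.upper 0 (3 * (K * t ^ 2)) le_rfl (by linarith) (by linarith)
    have h4 : 0 ≤ branch f J₀ (3 * (K * t ^ 2)) := Real.sqrt_nonneg _
    have h5 := D.profile.branch_anti (y := 3 * (K * t ^ 2)) le_rfl (by linarith) (by linarith)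
    have h6 := mul_le_mul_of_nonneg_right hWM ht.le
    have h7 : (branch f J₀ 0 - branch f J₀ (3 * (K * t ^ 2))) * branch f J₀ 0 ≤
        (W * t ^ 2) * branch f J₀ 0 := by
      nlinarith [mul_nonneg h4 (sub_nonneg.2 h5)]
    exact le_of_mul_le_mul_right h7 hg
  have hlow := D.le_u (x := 2 * (K * t ^ 2)) le_rfl (by linarith)
  rw [show 2 * (K * t ^ 2) + K * t ^ 2 = 3 * (K * t ^ 2) by ring] at hlow
  have hupp : u (2 * (K * t ^ 2)) ≤ branch f J₀ 0 :=
    (D.u_le (x := 2 * (K * t ^ 2)) (by linarith) (by linarith)).trans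
      (D.profile.branch_anti le_rfl (by linarith) (by linarith))
  rintro ⟨a, v⟩ ((⟨ha, hv⟩ | ⟨y, hy, hyv⟩) | ⟨ha, hv⟩)
  · have ha' : a = 0 := ha
    subst ha'
    have hnear : ∀ z, 0 ≤ z → z ≤ 2 * (K * t ^ 2) → |v - u z| ≤ W * t ^ 2 →
        ∃ x ∈ Icc (0:ℝ) 1, |(0:ℝ) - x| ≤ W * t ^ 2 ∧ |v - u x| ≤ W * t ^ 2 := fun z hz hz' hvz =>
      ⟨z, ⟨hz, by linarith⟩, by rw [zero_sub, abs_neg, abs_of_nonneg hz]; linarith, hvz⟩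
    have hW : |v - v| ≤ W * t ^ 2 := by
      rw [sub_self, abs_zero]; linarith
    have h2τ : 0 ≤ 2 * (K * t ^ 2) := by linarith
    have hc := hcont 0 (2 * (K * t ^ 2)) le_rfl (by linarith)
    dsimp only at hv ⊢
    rcases le_total u₀ (branch f J₀ 0) with hle | hle
    · rw [min_eq_left hle, max_eq_right hle] at hv
      rcases le_total v (u (2 * (K * t ^ 2))) with h | h
      · obtain ⟨z, hz, rfl⟩ := intermediate_value_Icc h2τ hc ⟨D.u_zero_le.trans hv.1, h⟩
        exact hnear z hz.1 hz.2 hW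
      · exact hnear _ h2τ le_rfl (by rw [abs_of_nonneg (by linarith)]; linarith [hv.2])
    · rw [min_eq_right hle, max_eq_left hle] at hv
      rcases le_total v (u 0) with h | h
      · obtain ⟨z, hz, rfl⟩ := intermediate_value_Icc' h2τ hc ⟨hupp.trans hv.1, h⟩
        exact hnear z hz.1 hz.2 hW
      · exact hnear _ le_rfl h2τ
          (by rw [abs_of_nonneg (by linarith)]; linarith [hv.2, D.le_u_zero])
  · obtain ⟨rfl, rfl⟩ := Prod.mk.inj hyv
    rcases le_total y (3 * (K * t ^ 2)) with h | h
    · refine ⟨2 * (K * t ^ 2), ⟨by linarith, by linarith⟩, ?_, ?_⟩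
      · rw [abs_le]
        constructor <;> dsimp only <;> linarith [hy.1]
      · have h1 := D.profile.branch_anti hy.1 h (by linarith)
        have h2 := D.profile.branch_anti le_rfl hy.1 hy.2
        rw [abs_le]
        constructor <;> dsimp only <;> linarith
    · have key : ∀ p q, p ≤ q → 0 ≤ p → q ≤ 1 → y - 3 * (K * t ^ 2) ≤ p →
          q ≤ y + 3 * (K * t ^ 2) → branch f J₀ y ≤ u p → u q ≤ branch f J₀ y →
          ∃ x ∈ Icc (0:ℝ) 1, |y - x| ≤ W * t ^ 2 ∧ |branch f J₀ y - u x| ≤ W * t ^ 2 := by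
        intro p q hpq hp hq hyp hyq hup huq
        obtain ⟨z, hz, hzu⟩ := intermediate_value_Icc' hpq (hcont p q hp hq) ⟨huq, hup⟩
        refine ⟨z, ⟨hp.trans hz.1, hz.2.trans hq⟩, ?_, ?_⟩
        · rw [abs_le]
          constructor <;> linarith [hz.1, hz.2]
        · rw [hzu, sub_self, abs_zero]; linarith
      rcases le_total y (1 - K * t ^ 2) with h' | h'
      · refine key (y - K * t ^ 2) (y + K * t ^ 2) (by linarith) (by linarith) (by linarith)
          (by linarith) (by linarith) ?_ ?_
        · have := D.le_u (x := y - K * t ^ 2) (by linarith) (by linarith)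
          rwa [sub_add_cancel] at this
        · have := D.u_le (x := y + K * t ^ 2) (by linarith) (by linarith)
          rwa [add_sub_cancel_right] at this
      · refine key (1 - 2 * (K * t ^ 2)) 1 (by linarith) (by linarith) le_rfl
          (by linarith [hy.2]) (by linarith) ?_ ?_
        · exact (D.profile.branch_anti (x := 1 - 2 * (K * t ^ 2) + K * t ^ 2) (by linarith)
            (by linarith) hy.2).trans (D.le_u (by linarith) (by linarith))
        · have h0 : 0 ≤ branch f J₀ y := Real.sqrt_nonneg _
          linarith [D.u_one_neg, D.b_pos]
  · have ha' : a = 1 := ha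
    subst ha'
    dsimp only at hv ⊢
    rcases le_total v (u 1) with h | h
    · refine ⟨1, ⟨zero_le_one, le_rfl⟩, by rw [sub_self, abs_zero]; linarith, ?_⟩
      rw [abs_le]
      constructor <;> linarith [hv.1, D.u_one_le]
    · have h0 := D.u_nonneg (x := 1 - K * t ^ 2) (by linarith) le_rfl
      obtain ⟨z, hz, rfl⟩ := intermediate_value_Icc' (show 1 - K * t ^ 2 ≤ 1 by linarith)
        (hcont _ _ (by linarith) le_rfl) ⟨h, hv.2.trans h0⟩
      refine ⟨z, ⟨by linarith [hz.1], hz.2⟩, ?_, by rw [sub_self, abs_zero]; linarith⟩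
      rw [abs_le]
      constructor <;> linarith [hz.1, hz.2]

end IsLayerFlow

open IsFluxProfile in
open scoped Topology in
set_option maxHeartbeats 1000000 in
/-- Uniform closeness of all boundary value solutions to the singular orbit, for small `t`. -/
lemma IsFluxProfile.exists_uniform_close {f : ℝ → ℝ} {m M J₀ α β : ℝ}
    (F : IsFluxProfile f m M J₀) (hfc : ContinuousOn (branch f J₀) (Icc 0 1))
    (hα0 : 0 < α) (hα : 1 / 2 - branch f J₀ 0 < α) (hβ : 1 / 2 < β) :
    ∃ W > 0, ∃ t₀ > 0, ∀ t ∈ Ioo (0:ℝ) t₀, ∀ (u : ℝ → ℝ) (J : ℝ),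
      IsRiccatiFlow t (fun x => 1 / 4 - J * f x) u →
      J * f 0 = α * (1 / 2 - u 0) → J * f 1 = β * (u 1 + 1 / 2) →
      (∀ x ∈ Icc (0:ℝ) 1, ∃ P ∈ singularOrbit (1 / 2 - J₀ * f 0 / α) (1 / (4 * β) - 1 / 2)
        (branch f J₀), |x - P.1| ≤ W * t ^ 2 ∧ |u x - P.2| ≤ W * t ^ 2) ∧
      (∀ P ∈ singularOrbit (1 / 2 - J₀ * f 0 / α) (1 / (4 * β) - 1 / 2) (branch f J₀),
        ∃ x ∈ Icc (0:ℝ) 1, |P.1 - x| ≤ W * t ^ 2 ∧ |P.2 - u x| ≤ W * t ^ 2) := by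
  have hm := F.m_pos
  have hM := F.M_pos
  have hJ₀ := F.J_pos
  have hf0 := F.f_pos
  have hf1 : 0 < f 1 := hf0.trans_le (F.mono le_rfl zero_le_one le_rfl)
  have hβ0 : 0 < β := by linarith
  have hgsq := F.branch_sq le_rfl zero_le_one
  have hg := F.branch_zero_pos
  set g := branch f J₀ 0 with hgdef
  set u₀ := 1 / 2 - J₀ * f 0 / α with hu₀
  set u₁ := 1 / (4 * β) - 1 / 2 with hu₁
  have hu₀g : 0 < u₀ + g := by
    have : u₀ + g = (1 / 2 + g) * (α - (1 / 2 - g)) / α := by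
      rw [hu₀, show J₀ * f 0 = 1 / 4 - g ^ 2 by linarith]
      field_simp
      ring
    rw [this]
    have : 0 < α - (1 / 2 - g) := by linarith
    positivity
  have hu₁neg : u₁ < 0 := by
    rw [hu₁, sub_neg, div_lt_div_iff₀ (by positivity) (by norm_num)]
    linarith
  obtain ⟨C, hC⟩ : ∃ C, C = (4 * M + 1) / f 0 := ⟨_, rfl⟩
  have hC0 : 0 < C := by rw [hC]; positivity
  have hCf : 4 * M + 1 ≤ C * f 0 := by rw [hC, div_mul_cancel₀ _ hf0.ne']
  obtain ⟨K, hK⟩ : ∃ K, K = 8 + (C * f 1 + 2) / m := ⟨_, rfl⟩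
  have hK8 : 8 ≤ K := by
    have : 0 < (C * f 1 + 2) / m := by positivity
    linarith
  have hmK : C * f 1 + 2 ≤ m * K := by
    rw [hK, mul_add, mul_div_cancel₀ _ hm.ne']
    linarith
  obtain ⟨B, hB⟩ : ∃ B, B = C * f 0 / α + C * f 1 / β := ⟨_, rfl⟩
  have hB1 : C * f 0 / α ≤ B := by
    have : 0 < C * f 1 / β := by positivity
    linarith
  have hB2 : C * f 1 / β ≤ B := by
    have : 0 < C * f 0 / α := by positivity
    linarith
  have hB0 : 0 < B := lt_of_lt_of_le (by positivity) hB1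
  obtain ⟨E, hE⟩ : ∃ E, E = B + (2 * M * K + C * f 1 + 1) / g := ⟨_, rfl⟩
  have hEB : B ≤ E := by
    have : 0 < (2 * M * K + C * f 1 + 1) / g := by positivity
    linarith
  have hEg : 2 * M * K + C * f 1 + 1 ≤ E * g := by
    rw [hE, add_mul, div_mul_cancel₀ _ hg.ne']
    linarith [mul_pos hB0 hg]
  obtain ⟨W, hW⟩ : ∃ W, W = E + 3 * K + 3 * M * K / g := ⟨_, rfl⟩
  have hE0 : 0 < E := hB0.trans_le hEB
  have hMKg : 0 < 3 * M * K / g := by positivity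
  have hWg : 3 * M * K ≤ W * g := by
    rw [hW, add_mul (E + 3 * K), div_mul_cancel₀ _ hg.ne']
    have : 0 < (E + 3 * K) * g := by positivity
    linarith
  obtain ⟨D, hD⟩ : ∃ D, D = g ^ 2 - (min u₀ 0) ^ 2 := ⟨_, rfl⟩
  have hD0 : 0 < D := by
    have : (min u₀ 0) ^ 2 < g ^ 2 :=
      sq_lt_sq' (lt_min (by linarith) (by linarith)) ((min_le_right _ _).trans_lt hg)
    linarith
  obtain ⟨κ, hκ0, hκ⟩ : ∃ κ > 0,
      D / 2 < g ^ 2 - κ * (M + f 1) - (min u₀ 0 - κ * f 0 / α) ^ 2 := by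
    have hc : Continuous fun κ : ℝ =>
        g ^ 2 - κ * (M + f 1) - (min u₀ 0 - κ * f 0 / α) ^ 2 := by fun_prop
    have h0 : D / 2 < g ^ 2 - 0 * (M + f 1) - (min u₀ 0 - 0 * f 0 / α) ^ 2 := by
      simp only [zero_mul, zero_div, sub_zero]
      linarith
    have hev := (hc.continuousAt (x := 0)).eventually (lt_mem_nhds h0)
    obtain ⟨κ, h1, h2⟩ := ((hev.filter_mono nhdsWithin_le_nhds).and
      (self_mem_nhdsWithin : Ioi (0:ℝ) ∈ 𝓝[>] (0:ℝ))).exists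
    exact ⟨κ, h2, h1⟩
  have ev : ∀ A a : ℝ, 0 < a → ∀ᶠ t in 𝓝[>] (0:ℝ), A * t ^ 2 < a := fun A a ha => by
    have hc : Continuous fun t : ℝ => A * t ^ 2 := by fun_prop
    refine ((hc.continuousAt (x := 0)).eventually (gt_mem_nhds ?_)).filter_mono
      nhdsWithin_le_nhds
    simpa using ha
  have ev' : ∀ A a : ℝ, 0 < a → ∀ᶠ t in 𝓝[>] (0:ℝ), A * t < a := fun A a ha => by
    have hc : Continuous fun t : ℝ => A * t := by fun_prop
    refine ((hc.continuousAt (x := 0)).eventually (gt_mem_nhds ?_)).filter_mono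
      nhdsWithin_le_nhds
    simpa using ha
  have hall := (ev (4 * K) 1 one_pos).and <| (ev C κ hκ0).and <| (ev K κ hκ0).and <|
    (ev (M * K) ((-u₁ / 2) ^ 2) (by nlinarith)).and <| (ev B (-u₁ / 2) (by linarith)).and <|
    (ev E g hg).and <| (ev (2 * E) (u₀ + g) hu₀g).and
    (ev' (-(min u₀ 0 - κ * f 0 / α)) (D / 2 * K) (by positivity))
  obtain ⟨t₀, ht₀, hsub⟩ := mem_nhdsGT_iff_exists_Ioo_subset.1 hall
  refine ⟨W, by rw [hW]; positivity, t₀, ht₀, fun t ht u J hu hbc0 hbc1 => ?_⟩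
  obtain ⟨h1, h2, h3, h4, h5, h6, h7, h8⟩ := hsub ht
  have htpos := ht.1
  have ht2 : 0 < t ^ 2 := by positivity
  have hτ : 8 * t ^ 2 ≤ K * t ^ 2 := mul_le_mul_of_nonneg_right hK8 ht2.le
  have hu0 : u 0 = 1 / 2 - J * f 0 / α := by
    rw [hbc0]; field_simp; ring
  have hu1 : u 1 = J * f 1 / β - 1 / 2 := by
    rw [hbc1]; field_simp; ring
  have hJle := F.le_flux_of_flow htpos (by linarith) hCf hu
  have hstart : ∃ y ∈ Icc 0 (K * t ^ 2), 0 ≤ u y := by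
    refine hu.exists_nonneg htpos (by linarith) (by linarith)
      (c := min u₀ 0 - κ * f 0 / α) (d := D / 2) ?_ (by positivity) (fun x hx => ?_) ?_
    · have h : J * f 0 / α ≤ (J₀ + κ) * f 0 / α := by gcongr; linarith
      have h' : (J₀ + κ) * f 0 / α = J₀ * f 0 / α + κ * f 0 / α := by ring
      rw [hu0]
      linarith [min_le_left u₀ 0]
    · have hx1 : x ≤ 1 := by linarith [hx.2]
      have e1 := F.mono hx.1 hx1 le_rfl
      have e2 := F.upper 0 x le_rfl hx.1 hx1
      have e3 : M * (x - 0) ≤ M * κ := mul_le_mul_of_nonneg_left (by linarith [hx.2]) hM.le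
      have e4 : J * f x ≤ (J₀ + κ) * f x := mul_le_mul_of_nonneg_right (by linarith)
        (hf0.trans_le (F.mono le_rfl hx.1 hx1)).le
      have e5 : κ * f x ≤ κ * f 1 := mul_le_mul_of_nonneg_left e1 hκ0.le
      linarith
    · have := mul_le_mul_of_nonneg_right h8.le ht2.le
      linarith
  have hβ4 : 1 / (4 * β) = 1 / 4 / β := by field_simp
  have hJge : J₀ ≤ J := by
    obtain ⟨y, hy, huy⟩ := hstart
    refine F.flux_ge_of_flow htpos hu ⟨hy.1, by linarith [hy.2]⟩ huy (fun hlt => ?_)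
    have e1 : J * f 1 / β ≤ J₀ * f 1 / β := by gcongr
    rw [F.crit] at e1
    linarith
  have hLF : IsLayerFlow f u m M J₀ J C K B u₀ u₁ (-u₁ / 2) t := by
    have e1 : J * f 1 / β ≤ (J₀ + C * t ^ 2) * f 1 / β := by gcongr
    have e2 : (J₀ + C * t ^ 2) * f 1 / β = J₀ * f 1 / β + C * f 1 / β * t ^ 2 := by ring
    have e3 : C * f 1 / β * t ^ 2 ≤ B * t ^ 2 := by gcongr
    have e4 : J₀ * f 1 / β ≤ J * f 1 / β := by gcongr
    have e5 : J * f 0 / α ≤ (J₀ + C * t ^ 2) * f 0 / α := by gcongr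
    have e6 : (J₀ + C * t ^ 2) * f 0 / α = J₀ * f 0 / α + C * f 0 / α * t ^ 2 := by ring
    have e7 : C * f 0 / α * t ^ 2 ≤ B * t ^ 2 := by gcongr
    have e8 : J₀ * f 0 / α ≤ J * f 0 / α := by gcongr
    rw [F.crit] at e2 e4
    have hle1 : u 1 ≤ u₁ + B * t ^ 2 := by linarith
    exact ⟨F, htpos, hu, hJge, hJle, hC0, hK8, hmK, by linarith, hstart, by linarith,
      by linarith, by linarith, hle1, by linarith, by linarith, by linarith⟩
  refine ⟨fun x hx => hLF.exists_orbit_near hfc hEB hEg h6.le (by linarith) ?_ ?_ hx.1 hx.2,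
    hLF.exists_graph_near ?_ ?_ hWg⟩ <;> linarith

/-- The reciprocal of a decreasing positive width, normalised by `k 1 / 4`. -/
lemma exists_isFluxProfile_inv {k k' : ℝ → ℝ}
    (hk : ∀ x ∈ Icc (0:ℝ) 1, HasDerivWithinAt k (k' x) (Icc 0 1) x)
    (hk'c : ContinuousOn k' (Icc 0 1)) (hkpos : ∀ x ∈ Icc (0:ℝ) 1, 0 < k x)
    (hk'neg : ∀ x ∈ Icc (0:ℝ) 1, k' x < 0) :
    ∃ m M, IsFluxProfile (fun x => (k x)⁻¹) m M (k 1 / 4) := by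
  have h0 : (0:ℝ) ∈ Icc (0:ℝ) 1 := ⟨le_rfl, zero_le_one⟩
  have h1 : (1:ℝ) ∈ Icc (0:ℝ) 1 := ⟨zero_le_one, le_rfl⟩
  have hk1 := hkpos 1 h1
  have hkc : ContinuousOn k (Icc 0 1) := fun x hx => (hk x hx).continuousWithinAt
  set D : ℝ → ℝ := fun x => k 1 / 4 * (-k' x / k x ^ 2) with hD
  have hder : ∀ x ∈ Icc (0:ℝ) 1,
      HasDerivWithinAt (fun x => k 1 / 4 * (k x)⁻¹) (D x) (Icc 0 1) x := fun x hx =>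
    ((hk x hx).fun_inv (hkpos x hx).ne').const_mul _
  have hDc : ContinuousOn D (Icc 0 1) :=
    continuousOn_const.mul (hk'c.neg.div (hkc.pow 2) fun x hx => (pow_pos (hkpos x hx) 2).ne')
  have hDpos : ∀ x ∈ Icc (0:ℝ) 1, 0 < D x := fun x hx =>
    mul_pos (by linarith) (div_pos (neg_pos.2 (hk'neg x hx)) (pow_pos (hkpos x hx) 2))
  obtain ⟨a, ha, hmin⟩ := isCompact_Icc.exists_isMinOn ⟨0, h0⟩ hDc
  obtain ⟨b, hb, hmax⟩ := isCompact_Icc.exists_isMaxOn ⟨0, h0⟩ hDc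
  refine ⟨D a, D b, hDpos a ha, hDpos b hb, by linarith, inv_pos.2 (hkpos 0 h0),
    by field_simp, fun x y hx hxy hy => ?_, fun x y hx hxy hy => ?_⟩
  · have hmono : MonotoneOn (fun x => k 1 / 4 * (k x)⁻¹ - D a * x) (Icc 0 1) := by
      have hd : ∀ x ∈ Icc (0:ℝ) 1, HasDerivWithinAt (fun x => k 1 / 4 * (k x)⁻¹ - D a * x)
          (D x - D a * 1) (Icc 0 1) x := fun x hx =>
        (hder x hx).sub ((hasDerivWithinAt_id x _).const_mul _)
      refine monotoneOn_of_hasDerivWithinAt_nonneg (convex_Icc 0 1)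
        (fun x hx => (hd x hx).continuousWithinAt)
        (fun x hx => (hd x (interior_subset hx)).mono interior_subset) (fun x hx => ?_)
      have := isMinOn_iff.1 hmin x (interior_subset hx)
      linarith
    have := hmono ⟨hx, hxy.trans hy⟩ ⟨hx.trans hxy, hy⟩ hxy
    simp only at this
    linarith
  · have hanti : AntitoneOn (fun x => k 1 / 4 * (k x)⁻¹ - D b * x) (Icc 0 1) := by
      have hd : ∀ x ∈ Icc (0:ℝ) 1, HasDerivWithinAt (fun x => k 1 / 4 * (k x)⁻¹ - D b * x)
          (D x - D b * 1) (Icc 0 1) x := fun x hx =>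
        (hder x hx).sub ((hasDerivWithinAt_id x _).const_mul _)
      refine antitoneOn_of_hasDerivWithinAt_nonpos (convex_Icc 0 1)
        (fun x hx => (hd x hx).continuousWithinAt)
        (fun x hx => (hd x (interior_subset hx)).mono interior_subset) (fun x hx => ?_)
      have := isMaxOn_iff.1 hmax x (interior_subset hx)
      linarith
    have := hanti ⟨hx, hxy.trans hy⟩ ⟨hx.trans hxy, hy⟩ hxy
    simp only at this
    linarith

lemma slowBranch34_eq {k : ℝ → ℝ} (x : ℝ) :
    slowBranch34 k x = 1 / 2 + IsFluxProfile.branch (fun x => (k x)⁻¹) (k 1 / 4) x := by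
  have h : 1 - k 1 / k x = 2 ^ 2 * (1 / 4 - k 1 / 4 * (k x)⁻¹) := by ring
  rw [slowBranch34, IsFluxProfile.branch, h, Real.sqrt_mul (by norm_num),
    Real.sqrt_sq (by norm_num)]
  ring

lemma rhoF_eq {k : ℝ → ℝ} :
    rhoF k = 1 / 2 - IsFluxProfile.branch (fun x => (k x)⁻¹) (k 1 / 4) 0 := by
  have := slowBranch34_eq (k := k) 0
  rw [slowBranch34] at this
  rw [rhoF]
  linarith

/-- The density of a classical solution, measured from `1/2`, is a Riccati flow. -/
lemma IsClassicalSolution.isRiccatiFlow {t α β J : ℝ} {k r r' : ℝ → ℝ} (ht : 0 < t)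
    (hkpos : ∀ x ∈ Icc (0:ℝ) 1, 0 < k x) (h : IsClassicalSolution 1 (t ^ 3) α β k r r' J) :
    IsRiccatiFlow t (fun x => 1 / 4 - J * (k x)⁻¹) (fun x => r x - 1 / 2) := by
  intro x hx
  refine ((h.1 x hx).sub_const (1 / 2)).congr_deriv ?_
  have h2 := h.2.2.1 x hx
  have hkx := (hkpos x hx).ne'
  rw [← h2]
  field_simp
  ring

/-- In region G₃ ∪ G₄, solutions are O(ε^(2/3))-close in Hausdorff distance to the singular
orbit consisting of a boundary layer at the entrance, the slow branch, and a boundary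
layer at the exit. -/
theorem hausdorff_convergence_region34
    (α β : ℝ) (k k' : ℝ → ℝ) (ρ ρ' : ℝ → ℝ → ℝ) (J : ℝ → ℝ)
    (hk : ∀ x ∈ Icc (0:ℝ) 1, HasDerivWithinAt k (k' x) (Icc 0 1) x)
    (hk'c : ContinuousOn k' (Icc 0 1))
    (hkpos : ∀ x ∈ Icc (0:ℝ) 1, 0 < k x)
    (hk'neg : ∀ x ∈ Icc (0:ℝ) 1, k' x < 0)
    (hα0 : rhoF k < α) (hα1 : α < 1) (hαne : α ≠ 1 - rhoF k)
    (hβ1 : 1/2 < β) (hβ2 : β < 1)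
    (hsol : ∀ ε > 0, IsClassicalSolution 1 ε α β k (ρ ε) (ρ' ε) (J ε)) :
    ∃ C > 0, ∃ ε₀ > 0, ∀ ε ∈ Ioo (0:ℝ) ε₀,
      Metric.hausdorffDist
        ((fun x => (x, ρ ε x)) '' Icc (0:ℝ) 1)
        ((({0} : Set ℝ) ×ˢ
            Icc (min (1 - k 1 / (4 * α * k 0)) (slowBranch34 k 0))
                (max (1 - k 1 / (4 * α * k 0)) (slowBranch34 k 0))) ∪
          ((fun x => (x, slowBranch34 k x)) '' Icc (0:ℝ) 1) ∪
          (({1} : Set ℝ) ×ˢ Icc (1 / (4 * β)) (1/2)))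
        ≤ C * ε ^ ((2:ℝ)/3) := by
  have h0 : (0:ℝ) ∈ Icc (0:ℝ) 1 := ⟨le_rfl, zero_le_one⟩
  have h1 : (1:ℝ) ∈ Icc (0:ℝ) 1 := ⟨zero_le_one, le_rfl⟩
  obtain ⟨m, M, F⟩ := exists_isFluxProfile_inv hk hk'c hkpos hk'neg
  have hkc : ContinuousOn k (Icc 0 1) := fun x hx => (hk x hx).continuousWithinAt
  have hfc : ContinuousOn (IsFluxProfile.branch (fun x => (k x)⁻¹) (k 1 / 4)) (Icc 0 1) :=
    (continuousOn_const.sub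
      (continuousOn_const.mul (hkc.inv₀ fun x hx => (hkpos x hx).ne'))).sqrt
  have hk0 := hkpos 0 h0
  have hk1 := hkpos 1 h1
  have hgle : IsFluxProfile.branch (fun x => (k x)⁻¹) (k 1 / 4) 0 ≤ 1 / 2 := by
    have hs := F.branch_sq le_rfl zero_le_one
    have : 0 < k 1 / 4 * (k 0)⁻¹ := by positivity
    nlinarith
  rw [rhoF_eq] at hα0
  have hαpos : 0 < α := by linarith
  have hβpos : 0 < β := by linarith
  obtain ⟨W, hW, t₀, ht₀, hclose⟩ := F.exists_uniform_close hfc hαpos hα0 hβ1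
  have hs0 : (1 - k 1 / (4 * α * k 0)) = (1 / 2 - k 1 / 4 * (k 0)⁻¹ / α) + 1 / 2 := by
    field_simp
    ring
  refine ⟨W, hW, t₀ ^ 3, by positivity, fun ε hε => ?_⟩
  obtain ⟨t, ht, rfl, htr⟩ : ∃ t, 0 < t ∧ t ^ 3 = ε ∧ ε ^ ((2:ℝ) / 3) = t ^ 2 := by
    refine ⟨ε ^ ((1:ℝ) / 3), Real.rpow_pos_of_pos hε.1 _, ?_, ?_⟩ <;>
    · rw [← Real.rpow_natCast, ← Real.rpow_mul hε.1.le]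
      norm_num
  have htt₀ : t < t₀ := lt_of_pow_lt_pow_left₀ 3 (le_of_lt ht₀) hε.2
  have hS := hsol (t ^ 3) hε.1
  have hJ0 := hS.2.2.1 0 h0
  have hJ1 := hS.2.2.1 1 h1
  rw [hS.2.2.2.1] at hJ0
  rw [hS.2.2.2.2] at hJ1
  obtain ⟨hnear, hnear'⟩ := hclose t ⟨ht, htt₀⟩ _ (J (t ^ 3)) (hS.isRiccatiFlow ht hkpos)
    (by rw [← hJ0]; field_simp; ring) (by rw [← hJ1]; field_simp; ring)
  rw [htr]
  refine Metric.hausdorffDist_le_of_mem_dist (by positivity) ?_ ?_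
  · rintro _ ⟨x, hx, rfl⟩
    obtain ⟨⟨a, v⟩, hP, hd1, hd2⟩ := hnear x hx
    refine ⟨(a, v + 1 / 2), ?_, ?_⟩
    · rcases hP with (⟨ha, hv⟩ | ⟨y, hy, hyv⟩) | ⟨ha, hv⟩
      · refine Or.inl (Or.inl ⟨ha, ?_⟩)
        rw [hs0, slowBranch34_eq, add_comm (1 / 2 : ℝ), min_add_add_right, max_add_add_right]
        exact ⟨add_le_add_left hv.1 _, add_le_add_left hv.2 _⟩
      · obtain ⟨rfl, rfl⟩ := Prod.mk.inj hyv
        exact Or.inl (Or.inr ⟨y, hy, by simp only [slowBranch34_eq, add_comm (1 / 2 : ℝ)]⟩)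
      · exact Or.inr ⟨ha, by linarith [hv.1], by linarith [hv.2]⟩
    · rw [Prod.dist_eq]
      refine max_le hd1 ?_
      rw [Real.dist_eq]
      refine (congrArg abs ?_).trans_le hd2
      dsimp only
      ring
  · have key : ∀ P ∈ singularOrbit (1 / 2 - k 1 / 4 * (k 0)⁻¹ / α) (1 / (4 * β) - 1 / 2)
        (IsFluxProfile.branch (fun x => (k x)⁻¹) (k 1 / 4)),
        ∃ q ∈ (fun x => (x, ρ (t ^ 3) x)) '' Icc (0:ℝ) 1,
          dist ((P.1, P.2 + 1 / 2) : ℝ × ℝ) q ≤ W * t ^ 2 := fun P hP => by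
      obtain ⟨x, hx, hd1, hd2⟩ := hnear' P hP
      refine ⟨_, ⟨x, hx, rfl⟩, ?_⟩
      rw [Prod.dist_eq]
      refine max_le hd1 ?_
      rw [Real.dist_eq]
      refine (congrArg abs ?_).trans_le hd2
      dsimp only
      ring
    rintro ⟨a, v⟩ hP
    have hP' := key (a, v - 1 / 2) ?_
    · simpa only [sub_add_cancel] using hP'
    · rcases hP with (⟨ha, hv⟩ | ⟨y, hy, hyv⟩) | ⟨ha, hv⟩
      · refine Or.inl (Or.inl ⟨ha, ?_⟩)
        rw [hs0, slowBranch34_eq, add_comm (1 / 2 : ℝ), min_add_add_right,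
          max_add_add_right] at hv
        exact ⟨le_sub_iff_add_le.2 hv.1, sub_le_iff_le_add.2 hv.2⟩
      · obtain ⟨rfl, rfl⟩ := Prod.mk.inj hyv
        exact Or.inl (Or.inr ⟨y, hy, by simp only [slowBranch34_eq, add_sub_cancel_left]⟩)
      · exact Or.inr ⟨ha, by linarith [hv.1], by linarith [hv.2]⟩
end
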